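/- (Time-independent upper bound of the density) Suppose γ > 1 and max{1, (γ+2)/4} < β ≤ γ, and let (ρ, u) be a radially symmetric strong solution on [0,R] × [0,T]. Then there is a constant C > 0 depending only on μ, β, γ, ‖ρ₀‖_{L^∞} and ‖u₀‖_{H¹}, but independent of T, such that sup_{(r,t) ∈ [0,R]×[0,T]} ρ(r,t) ≤ C. -/

import Mathlib

open MeasureTheory Set Filter

noncomputable section

/-- Radial divergence `u_r + u/r` of the 2D radial vector field `x ↦ u(|x|,t) x/|x|`. -/
def rdiv (u : ℝ → ℝ → ℝ) (r t : ℝ) : ℝ := deriv (fun s => u s t) r + u r t / r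

/-- Squared gradient `u_r² + u²/r²` of the 2D radial vector field. -/
def gradSq (u : ℝ → ℝ → ℝ) (r t : ℝ) : ℝ :=
  (deriv (fun s => u s t) r) ^ 2 + (u r t / r) ^ 2

/-- Material derivative `u̇ = u_t + u u_r` of the radial velocity. -/
def mder (u : ℝ → ℝ → ℝ) (r t : ℝ) : ℝ :=
  deriv (fun τ => u r τ) t + u r t * deriv (fun s => u s t) r

/-- Effective viscous flux `F = (2μ + ρ^β)(u_r + u/r) - ρ^γ`. -/
def flux (μ β γ : ℝ) (ρ u : ℝ → ℝ → ℝ) (r t : ℝ) : ℝ :=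
  (2 * μ + ρ r t ^ β) * rdiv u r t - ρ r t ^ γ

/-- A radially symmetric (smooth, strong) solution on `[0,R] × [0,T]` of the isentropic
compressible Navier–Stokes system with `μ > 0`, `λ(ρ) = ρ^β`, `P(ρ) = ρ^γ`, written in
radial coordinates: `ρ_t + (ρu)_r + ρu/r = 0` and
`(ρu)_t + (ρu²)_r + ρu²/r + (ρ^γ)_r = [(2μ + ρ^β)(u_r + u/r)]_r`, with Dirichlet
boundary conditions `u(0,t) = u(R,t) = 0`. -/
structure RadialSolution (μ β γ R T : ℝ) (ρ u : ℝ → ℝ → ℝ) : Prop where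
  hμ : 0 < μ
  hβ : 1 < β
  hγ : 1 < γ
  hR : 0 < R
  hT : 0 < T
  smooth_ρ : ∀ n : ℕ, ContDiff ℝ n (Function.uncurry ρ)
  smooth_u : ∀ n : ℕ, ContDiff ℝ n (Function.uncurry u)
  ρ_pos : ∀ r ∈ Icc 0 R, ∀ t ∈ Icc 0 T, 0 < ρ r t
  mass : ∀ r ∈ Ioo 0 R, ∀ t ∈ Icc 0 T,
    deriv (fun τ => ρ r τ) t + deriv (fun s => ρ s t * u s t) r + ρ r t * u r t / r = 0
  momentum : ∀ r ∈ Ioo 0 R, ∀ t ∈ Icc 0 T,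
    deriv (fun τ => ρ r τ * u r τ) t + deriv (fun s => ρ s t * u s t ^ 2) r
      + ρ r t * u r t ^ 2 / r + deriv (fun s => ρ s t ^ γ) r
      = deriv (fun s => (2 * μ + ρ s t ^ β) * rdiv u s t) r
  bc0 : ∀ t ∈ Icc 0 T, u 0 t = 0
  bcR : ∀ t ∈ Icc 0 T, u R t = 0

lemma hasDerivAt_param {a R T : ℝ} (haR : a ≤ R) {f f' : ℝ → ℝ → ℝ}
    (hf : ∀ t ∈ Icc 0 T, ContinuousOn (fun r => f r t) (Icc a R))
    (hf' : ContinuousOn (fun p : ℝ × ℝ => f' p.1 p.2) (Icc a R ×ˢ Icc 0 T))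
    (hd : ∀ r ∈ Icc a R, ∀ t ∈ Icc 0 T, HasDerivAt (fun τ => f r τ) (f' r t) t)
    {t0 : ℝ} (ht : t0 ∈ Ioo 0 T) :
    HasDerivAt (fun t => ∫ r in a..R, f r t) (∫ r in a..R, f' r t0) t0 := by
  obtain ⟨C, hC⟩ := (isCompact_Icc.prod isCompact_Icc).exists_bound_of_continuousOn hf'
  have hsub : uIoc a R ⊆ Icc a R := by rw [uIoc_of_le haR]; exact Ioc_subset_Icc_self
  have hmeas : ∀ g : ℝ → ℝ, ContinuousOn g (Icc a R) →
      AEStronglyMeasurable g (volume.restrict (uIoc a R)) := fun g hg =>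
    (hg.mono hsub).aestronglyMeasurable measurableSet_uIoc
  have hs : Ioo 0 T ∈ nhds t0 := isOpen_Ioo.mem_nhds ht
  have hslice : ContinuousOn (fun r => f' r t0) (Icc a R) := by
    have : ContinuousOn (fun r : ℝ => (r, t0)) (Icc a R) := by fun_prop
    exact hf'.comp this (fun r hr => ⟨hr, Ioo_subset_Icc_self ht⟩)
  refine (intervalIntegral.hasDerivAt_integral_of_dominated_loc_of_deriv_le (μ := volume)
    (F := fun t r => f r t) (F' := fun t r => f' r t) (bound := fun _ => C) hs ?_ ?_ ?_ ?_ ?_ ?_).2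
  · filter_upwards [hs] with x hx
    exact hmeas _ (hf x (Ioo_subset_Icc_self hx))
  · exact ContinuousOn.intervalIntegrable_of_Icc haR (hf t0 (Ioo_subset_Icc_self ht))
  · exact hmeas _ hslice
  · refine Eventually.of_forall fun r hr t ht => ?_
    exact hC (r, t) ⟨hsub hr, Ioo_subset_Icc_self ht⟩
  · exact intervalIntegrable_const
  · refine Eventually.of_forall fun r hr t ht => ?_
    exact hd r (hsub hr) t (Ioo_subset_Icc_self ht)

lemma contOn_param {R T : ℝ} (hR : 0 ≤ R) (hT : 0 ≤ T) {f : ℝ → ℝ → ℝ}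
    (hf : ContinuousOn (fun p : ℝ × ℝ => f p.1 p.2) (Icc 0 R ×ˢ Icc 0 T)) :
    ContinuousOn (fun t => ∫ r in (0:ℝ)..R, f r t) (Icc 0 T) := by
  have hc : Continuous (fun p : ℝ × ℝ => f (max 0 (min R p.2)) (max 0 (min T p.1))) := by
    have : Continuous (fun p : ℝ × ℝ => ((max 0 (min R p.2), max 0 (min T p.1)) : ℝ × ℝ)) := by
      fun_prop
    refine hf.comp_continuous this (fun p => ⟨⟨?_, ?_⟩, ⟨?_, ?_⟩⟩)
    · exact le_max_left _ _
    · exact max_le hR (min_le_left _ _)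
    · exact le_max_left _ _
    · exact max_le hT (min_le_left _ _)
  have h2 := intervalIntegral.continuous_parametric_intervalIntegral_of_continuous (μ := volume)
    (f := fun t r => f (max 0 (min R r)) (max 0 (min T t))) (a₀ := 0) hc (s := fun _ => R)
    continuous_const
  refine h2.continuousOn.congr fun t ht => ?_
  refine intervalIntegral.integral_congr fun r hr => ?_
  rw [uIcc_of_le hR] at hr
  simp only [min_eq_right hr.2, max_eq_right hr.1, min_eq_right ht.2, max_eq_right ht.1]

lemma ii_of {R : ℝ} (hR : 0 ≤ R) {f : ℝ → ℝ} (hf : ContinuousOn f (Icc 0 R)) :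
    IntervalIntegrable f volume 0 R := hf.intervalIntegrable_of_Icc hR

lemma int_mono {R : ℝ} (hR : 0 ≤ R) {f g : ℝ → ℝ} (hf : ContinuousOn f (Icc 0 R))
    (hg : ContinuousOn g (Icc 0 R)) (h : ∀ r ∈ Icc 0 R, f r ≤ g r) :
    ∫ r in (0:ℝ)..R, f r ≤ ∫ r in (0:ℝ)..R, g r :=
  intervalIntegral.integral_mono_on hR (ii_of hR hf) (ii_of hR hg) h

lemma int_nonneg {R : ℝ} (hR : 0 ≤ R) {f : ℝ → ℝ} (h : ∀ r ∈ Icc 0 R, 0 ≤ f r) :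
    0 ≤ ∫ r in (0:ℝ)..R, f r :=
  intervalIntegral.integral_nonneg hR h

lemma cs_weight {R : ℝ} (hR : 0 ≤ R) {f g : ℝ → ℝ} (hf : ContinuousOn f (Icc 0 R))
    (hg : ContinuousOn g (Icc 0 R)) :
    (∫ r in (0:ℝ)..R, f r * g r * r) ^ 2 ≤
      (∫ r in (0:ℝ)..R, f r ^ 2 * r) * (∫ r in (0:ℝ)..R, g r ^ 2 * r) := by
  have key : ∀ x : ℝ, 0 ≤ (∫ r in (0:ℝ)..R, f r ^ 2 * r) * (x * x)
      + (2 * ∫ r in (0:ℝ)..R, f r * g r * r) * x + ∫ r in (0:ℝ)..R, g r ^ 2 * r := by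
    intro x
    have h0 : 0 ≤ ∫ r in (0:ℝ)..R, (x * f r + g r) ^ 2 * r :=
      int_nonneg hR fun r hr => mul_nonneg (sq_nonneg _) hr.1
    have h1 : ∫ r in (0:ℝ)..R, (x * f r + g r) ^ 2 * r =
        (x * x) * (∫ r in (0:ℝ)..R, f r ^ 2 * r)
        + (2 * x) * (∫ r in (0:ℝ)..R, f r * g r * r) + ∫ r in (0:ℝ)..R, g r ^ 2 * r := by
      rw [← intervalIntegral.integral_const_mul, ← intervalIntegral.integral_const_mul,
        ← intervalIntegral.integral_add, ← intervalIntegral.integral_add]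
      · refine intervalIntegral.integral_congr fun r _ => ?_
        ring
      all_goals exact ii_of hR (by fun_prop)
    rw [h1] at h0
    linarith
  have := discrim_le_zero key
  unfold discrim at this
  nlinarith

lemma int_le_of_bound {R : ℝ} (hR : 0 ≤ R) {a b : ℝ} (ha : a ∈ Icc 0 R) (hb : b ∈ Icc a R)
    {f g : ℝ → ℝ} (hf : ContinuousOn f (Icc 0 R))
    (hg : ContinuousOn g (Icc 0 R)) (h : ∀ r ∈ Icc 0 R, f r ≤ g r) (h0 : ∀ r ∈ Icc 0 R, 0 ≤ g r) :
    ∫ r in a..b, f r ≤ ∫ r in (0:ℝ)..R, g r := by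
  have hsub : Icc a b ⊆ Icc 0 R := Icc_subset_Icc ha.1 hb.2
  calc ∫ r in a..b, f r ≤ ∫ r in a..b, g r :=
        intervalIntegral.integral_mono_on hb.1 ((hf.mono hsub).intervalIntegrable_of_Icc hb.1)
          ((hg.mono hsub).intervalIntegrable_of_Icc hb.1) (fun r hr => h r (hsub hr))
    _ ≤ _ := by
        apply intervalIntegral.integral_mono_interval ha.1 hb.1 hb.2
        · rw [EventuallyLE, ae_restrict_iff' measurableSet_Ioc]
          exact Eventually.of_forall fun r hr => h0 r (Ioc_subset_Icc_self hr)
        · exact ii_of hR hg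

lemma gn_step {R : ℝ} (hR : 0 < R) {g g' : ℝ → ℝ}
    (hg : ∀ r ∈ Icc 0 R, HasDerivAt g (g' r) r) (hg' : ContinuousOn g' (Icc 0 R)) :
    ∫ r in (0:ℝ)..R, g r ^ 2 * r ≤ (3 / 2) *
      (2 * (∫ r in (0:ℝ)..R, |g' r| * r) + (2 / R) * ∫ r in (0:ℝ)..R, |g r| * r) ^ 2 := by
  have hgc : ContinuousOn g (Icc 0 R) := fun r hr => (hg r hr).continuousAt.continuousWithinAt
  set I1 := ∫ r in (0:ℝ)..R, |g' r| * r with hI1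
  set I0 := ∫ r in (0:ℝ)..R, |g r| * r with hI0
  have hI1n : 0 ≤ I1 := int_nonneg hR.le fun r hr => mul_nonneg (abs_nonneg _) hr.1
  have hI0n : 0 ≤ I0 := int_nonneg hR.le fun r hr => mul_nonneg (abs_nonneg _) hr.1
  -- value at R
  have hRR : R * |g R| ≤ (2 / R) * I0 + I1 := by
    have h1 : ∫ r in (0:ℝ)..R, (2 * r * g r + r ^ 2 * g' r) = R ^ 2 * g R - 0 ^ 2 * g 0 := by
      apply intervalIntegral.integral_eq_sub_of_hasDerivAt_of_le hR.le
        (f := fun r => r ^ 2 * g r)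
      · fun_prop
      · intro x hx
        have := ((hasDerivAt_id x).pow 2).mul (hg x (Ioo_subset_Icc_self hx))
        refine this.congr_deriv ?_
        simp
      · exact ii_of hR.le (by fun_prop)
    have h2 : |∫ r in (0:ℝ)..R, (2 * r * g r + r ^ 2 * g' r)| ≤ 2 * I0 + R * I1 := by
      refine (intervalIntegral.abs_integral_le_integral_abs hR.le).trans ?_
      rw [hI0, hI1, ← intervalIntegral.integral_const_mul, ← intervalIntegral.integral_const_mul,
        ← intervalIntegral.integral_add (ii_of hR.le (by fun_prop)) (ii_of hR.le (by fun_prop))]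
      refine int_mono hR.le (by fun_prop) (by fun_prop) fun r hr => ?_
      refine (abs_add_le _ _).trans ?_
      rw [abs_mul, abs_mul, abs_mul, abs_of_nonneg hr.1, abs_of_nonneg (sq_nonneg r), abs_two]
      have : r ^ 2 * |g' r| ≤ R * (|g' r| * r) := by
        have := mul_le_mul_of_nonneg_right hr.2 (mul_nonneg (abs_nonneg (g' r)) hr.1)
        nlinarith
      nlinarith
    rw [h1] at h2
    have h3 : |R ^ 2 * g R - 0 ^ 2 * g 0| = R * (R * |g R|) := by
      rw [zero_pow two_ne_zero, zero_mul, sub_zero, abs_mul, abs_of_nonneg (sq_nonneg R)]; ring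
    rw [h3] at h2
    have : R * ((2 / R) * I0 + I1) = 2 * I0 + R * I1 := by field_simp
    rw [← this] at h2
    exact le_of_mul_le_mul_left h2 hR
  set K := 2 * I1 + (2 / R) * I0 with hK
  have hsup : ∀ r ∈ Icc 0 R, r * |g r| ≤ K := by
    intro r hr
    have h1 : ∫ s in r..R, g' s = g R - g r :=
      intervalIntegral.integral_eq_sub_of_hasDerivAt_of_le hr.2 (hgc.mono (Icc_subset_Icc hr.1 le_rfl))
        (fun x hx => hg x ⟨hr.1.trans hx.1.le, hx.2.le⟩)
        ((hg'.mono (Icc_subset_Icc hr.1 le_rfl)).intervalIntegrable_of_Icc hr.2)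
    have h2 : r * |g R - g r| ≤ I1 := by
      rw [← h1]
      have : r * |∫ s in r..R, g' s| ≤ r * ∫ s in r..R, |g' s| :=
        mul_le_mul_of_nonneg_left (intervalIntegral.abs_integral_le_integral_abs hr.2) hr.1
      refine this.trans ?_
      rw [← intervalIntegral.integral_const_mul]
      calc ∫ s in r..R, r * |g' s| ≤ ∫ s in r..R, |g' s| * s := by
            have hs : Icc r R ⊆ Icc 0 R := Icc_subset_Icc hr.1 le_rfl
            have hg'' := hg'.mono hs
            apply intervalIntegral.integral_mono_on hr.2
            · exact ContinuousOn.intervalIntegrable_of_Icc hr.2 (by fun_prop)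
            · exact ContinuousOn.intervalIntegrable_of_Icc hr.2 (by fun_prop)
            · intro s hs
              rw [mul_comm]
              exact mul_le_mul_of_nonneg_left hs.1 (abs_nonneg _)
        _ ≤ I1 := int_le_of_bound hR.le hr ⟨hr.2, le_rfl⟩ (by fun_prop) (by fun_prop)
            (fun _ _ => le_rfl) (fun s hs => mul_nonneg (abs_nonneg _) hs.1)
    have h3 : |g r| ≤ |g R| + |g R - g r| := by
      have := abs_sub_abs_le_abs_sub (g r) (g R)
      rw [abs_sub_comm] at this
      linarith
    have h4 : r * |g R| ≤ R * |g R| := mul_le_mul_of_nonneg_right hr.2 (abs_nonneg _)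
    nlinarith [mul_le_mul_of_nonneg_left h3 hr.1]
  have hKn : 0 ≤ K := by positivity
  have hparts : ∫ r in (0:ℝ)..R, (g r ^ 2 * r + r ^ 2 * g r * g' r) = R ^ 2 * g R ^ 2 / 2 - 0 ^ 2 * g 0 ^ 2 / 2 := by
    apply intervalIntegral.integral_eq_sub_of_hasDerivAt_of_le hR.le
      (f := fun r => r ^ 2 * g r ^ 2 / 2)
    · fun_prop
    · intro x hx
      have := (((hasDerivAt_id x).pow 2).mul ((hg x (Ioo_subset_Icc_self hx)).pow 2)).div_const 2
      refine this.congr_deriv ?_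
      simp
      ring
    · exact ii_of hR.le (by fun_prop)
  rw [intervalIntegral.integral_add (ii_of hR.le (by fun_prop)) (ii_of hR.le (by fun_prop))] at hparts
  have h5 : -(∫ r in (0:ℝ)..R, r ^ 2 * g r * g' r) ≤ K * I1 := by
    rw [hI1, ← intervalIntegral.integral_neg, ← intervalIntegral.integral_const_mul]
    refine int_mono hR.le (by fun_prop) (by fun_prop) fun r hr => ?_
    have h6 : -(r ^ 2 * g r * g' r) ≤ (r * |g r|) * (|g' r| * r) := by
      refine (neg_le_abs _).trans (le_of_eq ?_)
      rw [abs_mul, abs_mul, abs_of_nonneg (sq_nonneg r)]; ring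
    exact h6.trans (mul_le_mul_of_nonneg_right (hsup r hr) (mul_nonneg (abs_nonneg _) hr.1))
  have h7 : R ^ 2 * g R ^ 2 / 2 ≤ K ^ 2 / 2 := by
    have := hsup R ⟨hR.le, le_rfl⟩
    have h8 : R ^ 2 * g R ^ 2 = (R * |g R|) ^ 2 := by rw [mul_pow, sq_abs]
    rw [h8]
    have h9 : 0 ≤ R * |g R| := by positivity
    nlinarith
  have h10 : I1 ≤ K := by
    have : 0 ≤ (2 / R) * I0 := by positivity
    linarith
  nlinarith [mul_le_mul_of_nonneg_left h10 hKn]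

/-- Radial Gagliardo-Nirenberg. -/
lemma gn {R : ℝ} (hR : 0 < R) (m : ℕ) : ∃ C > 0, ∀ F F' : ℝ → ℝ,
    (∀ r ∈ Icc 0 R, HasDerivAt F (F' r) r) → ContinuousOn F' (Icc 0 R) →
    ∫ r in (0:ℝ)..R, (F r ^ (m + 1)) ^ 2 * r ≤
      C * ((∫ r in (0:ℝ)..R, F' r ^ 2 * r) + ∫ r in (0:ℝ)..R, F r ^ 2 * r) ^ m
        * ∫ r in (0:ℝ)..R, F r ^ 2 * r := by
  induction m with
  | zero =>
    refine ⟨1, one_pos, fun F F' _ _ => ?_⟩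
    simp
  | succ m ih =>
    obtain ⟨C, hC, h⟩ := ih
    refine ⟨(3 / 2) * (8 * (m + 2) ^ 2 + 8 / R ^ 2) * C, by positivity, fun F F' hF hF' => ?_⟩
    have hFc : ContinuousOn F (Icc 0 R) := fun r hr => (hF r hr).continuousAt.continuousWithinAt
    have hm := h F F' hF hF'
    set b := ∫ r in (0:ℝ)..R, F' r ^ 2 * r with hb
    set f := ∫ r in (0:ℝ)..R, F r ^ 2 * r with hf
    set J := ∫ r in (0:ℝ)..R, (F r ^ (m + 1)) ^ 2 * r with hJ
    have hbn : 0 ≤ b := int_nonneg hR.le fun r hr => mul_nonneg (sq_nonneg _) hr.1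
    have hfn : 0 ≤ f := int_nonneg hR.le fun r hr => mul_nonneg (sq_nonneg _) hr.1
    have hJn : 0 ≤ J := int_nonneg hR.le fun r hr => mul_nonneg (sq_nonneg _) hr.1
    have hs := gn_step hR (g := fun r => F r ^ (m + 2))
      (g' := fun r => (m + 2) * F r ^ (m + 1) * F' r)
      (fun r hr => ((hF r hr).pow (m + 2)).congr_deriv (by push_cast; simp))
      (by fun_prop)
    have e1 : ∫ r in (0:ℝ)..R, |(m + 2) * F r ^ (m + 1) * F' r| * r =
        (m + 2) * ∫ r in (0:ℝ)..R, |F r ^ (m + 1)| * |F' r| * r := by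
      rw [← intervalIntegral.integral_const_mul]
      refine intervalIntegral.integral_congr fun r _ => ?_
      simp only [abs_mul]
      rw [abs_of_nonneg (by positivity : (0:ℝ) ≤ (m:ℝ) + 2)]; ring
    have e2 : ∫ r in (0:ℝ)..R, |F r ^ (m + 2)| * r =
        ∫ r in (0:ℝ)..R, |F r ^ (m + 1)| * |F r| * r := by
      refine intervalIntegral.integral_congr fun r _ => ?_
      simp only [← abs_mul, ← pow_succ]
    have c1 := cs_weight hR.le (f := fun r => |F r ^ (m + 1)|) (g := fun r => |F' r|)
      (by fun_prop) (by fun_prop)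
    have c2 := cs_weight hR.le (f := fun r => |F r ^ (m + 1)|) (g := fun r => |F r|)
      (by fun_prop) (by fun_prop)
    simp only [sq_abs] at c1 c2
    rw [← hJ, ← hb] at c1
    rw [← hJ, ← hf] at c2
    rw [e1, e2] at hs
    set a1 := ∫ r in (0:ℝ)..R, |F r ^ (m + 1)| * |F' r| * r
    set a2 := ∫ r in (0:ℝ)..R, |F r ^ (m + 1)| * |F r| * r
    have hstep : ∫ r in (0:ℝ)..R, (F r ^ (m + 1 + 1)) ^ 2 * r ≤
        (3 / 2) * (8 * (m + 2) ^ 2 + 8 / R ^ 2) * ((b + f) * J) := by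
      refine hs.trans ?_
      have k1 : (2 * ((m + 2) * a1) + 2 / R * a2) ^ 2 ≤
          8 * (m + 2) ^ 2 * a1 ^ 2 + 8 / R ^ 2 * a2 ^ 2 := by
        have : 8 * ((m:ℝ) + 2) ^ 2 * a1 ^ 2 + 8 / R ^ 2 * a2 ^ 2
            - (2 * ((m + 2) * a1) + 2 / R * a2) ^ 2 = (2 * ((m + 2) * a1) - 2 / R * a2) ^ 2 := by
          field_simp; ring
        nlinarith [sq_nonneg (2 * ((m + 2) * a1) - 2 / R * a2)]
      have k2 : 8 * ((m:ℝ) + 2) ^ 2 * a1 ^ 2 ≤ 8 * (m + 2) ^ 2 * ((b + f) * J) := by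
        apply mul_le_mul_of_nonneg_left _ (by positivity)
        nlinarith
      have k3 : 8 / R ^ 2 * a2 ^ 2 ≤ 8 / R ^ 2 * ((b + f) * J) := by
        apply mul_le_mul_of_nonneg_left _ (by positivity)
        nlinarith
      nlinarith
    refine hstep.trans ?_
    have : (b + f) * J ≤ C * (b + f) ^ (m + 1) * f := by
      calc (b + f) * J ≤ (b + f) * (C * (b + f) ^ m * f) :=
            mul_le_mul_of_nonneg_left hm (by positivity)
        _ = _ := by ring
    calc _ ≤ (3 / 2) * (8 * (m + 2) ^ 2 + 8 / R ^ 2) * (C * (b + f) ^ (m + 1) * f) :=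
          mul_le_mul_of_nonneg_left this (by positivity)
      _ = _ := by ring

structure Sol (μ β γ R T : ℝ) where
  (ρ ρr u ur ut v w wr wt L Lr P Pr : ℝ → ℝ → ℝ)
  hμ : 0 < μ
  hβ : 1 < β
  hγ : 1 < γ
  hR : 0 < R
  hT : 0 < T
  cρ : Continuous (fun p : ℝ × ℝ => ρ p.1 p.2)
  cu : Continuous (fun p : ℝ × ℝ => u p.1 p.2)
  cρr : Continuous (fun p : ℝ × ℝ => ρr p.1 p.2)
  cur : Continuous (fun p : ℝ × ℝ => ur p.1 p.2)
  cut : Continuous (fun p : ℝ × ℝ => ut p.1 p.2)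
  cv : Continuous (fun p : ℝ × ℝ => v p.1 p.2)
  cw : Continuous (fun p : ℝ × ℝ => w p.1 p.2)
  cwr : Continuous (fun p : ℝ × ℝ => wr p.1 p.2)
  cwt : Continuous (fun p : ℝ × ℝ => wt p.1 p.2)
  cL : ContinuousOn (fun p : ℝ × ℝ => L p.1 p.2) (Icc 0 R ×ˢ Icc 0 T)
  cLr : ContinuousOn (fun p : ℝ × ℝ => Lr p.1 p.2) (Icc 0 R ×ˢ Icc 0 T)
  cP : ContinuousOn (fun p : ℝ × ℝ => P p.1 p.2) (Icc 0 R ×ˢ Icc 0 T)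
  cPr : ContinuousOn (fun p : ℝ × ℝ => Pr p.1 p.2) (Icc 0 R ×ˢ Icc 0 T)
  pos : ∀ r ∈ Icc 0 R, ∀ t ∈ Icc 0 T, 0 < ρ r t
  dρr : ∀ r ∈ Icc 0 R, ∀ t ∈ Icc 0 T, HasDerivAt (fun s => ρ s t) (ρr r t) r
  dρt : ∀ r ∈ Icc 0 R, ∀ t ∈ Icc 0 T,
    HasDerivAt (fun τ => ρ r τ) (-(u r t * ρr r t) - ρ r t * w r t) t
  dur : ∀ r ∈ Icc 0 R, ∀ t ∈ Icc 0 T, HasDerivAt (fun s => u s t) (ur r t) r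
  dut : ∀ r ∈ Icc 0 R, ∀ t ∈ Icc 0 T, HasDerivAt (fun τ => u r τ) (ut r t) t
  dwr : ∀ r ∈ Icc 0 R, ∀ t ∈ Icc 0 T, HasDerivAt (fun s => w s t) (wr r t) r
  dwt : ∀ r ∈ Icc 0 R, ∀ t ∈ Icc 0 T, HasDerivAt (fun τ => w r τ) (wt r t) t
  dLr : ∀ r ∈ Icc 0 R, ∀ t ∈ Icc 0 T, HasDerivAt (fun s => L s t) (Lr r t) r
  dLt : ∀ r ∈ Icc 0 R, ∀ t ∈ Icc 0 T,
    HasDerivAt (fun τ => L r τ) (-(u r t * Lr r t) - β * L r t * w r t) t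
  dPr : ∀ r ∈ Icc 0 R, ∀ t ∈ Icc 0 T, HasDerivAt (fun s => P s t) (Pr r t) r
  dPt : ∀ r ∈ Icc 0 R, ∀ t ∈ Icc 0 T,
    HasDerivAt (fun τ => P r τ) (-(u r t * Pr r t) - γ * P r t * w r t) t
  dru : ∀ r ∈ Icc 0 R, ∀ t ∈ Icc 0 T, HasDerivAt (fun s => s * ut s t) (r * wt r t) r
  mom : ∀ r ∈ Icc 0 R, ∀ t ∈ Icc 0 T,
    Lr r t * w r t + (2 * μ + L r t) * wr r t - Pr r t = ρ r t * (ut r t + u r t * ur r t)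
  hv : ∀ r ∈ Icc 0 R, ∀ t ∈ Icc 0 T, u r t = r * v r t
  hw : ∀ r ∈ Icc 0 R, ∀ t ∈ Icc 0 T, w r t = ur r t + v r t
  bcR : ∀ t ∈ Icc 0 T, u R t = 0
  bcRt : ∀ t ∈ Icc 0 T, ut R t = 0
  hL : ∀ r t, L r t = ρ r t ^ β
  hP : ∀ r t, P r t = ρ r t ^ γ

lemma slice {R T t : ℝ} (ht : t ∈ Icc 0 T) {f : ℝ → ℝ → ℝ}
    (hf : ContinuousOn (fun p : ℝ × ℝ => f p.1 p.2) (Icc 0 R ×ˢ Icc 0 T)) :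
    ContinuousOn (fun r => f r t) (Icc 0 R) := by
  have : ContinuousOn (fun r : ℝ => (r, t)) (Icc 0 R) := by fun_prop
  exact hf.comp this (fun r hr => ⟨hr, ht⟩)

namespace Sol

variable {μ β γ R T : ℝ} (S : Sol μ β γ R T)

/-- effective viscous flux -/
def F (r t : ℝ) : ℝ := (2 * μ + S.L r t) * S.w r t - S.P r t
/-- material derivative -/
def ud (r t : ℝ) : ℝ := S.ut r t + S.u r t * S.ur r t
/-- dissipation -/
def X (t : ℝ) : ℝ := ∫ r in (0:ℝ)..R, (2 * μ + S.L r t) * S.w r t ^ 2 * r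
def W (t : ℝ) : ℝ := ∫ r in (0:ℝ)..R, S.w r t ^ 2 * r
def B2 (t : ℝ) : ℝ := ∫ r in (0:ℝ)..R, S.ρ r t * S.ud r t ^ 2 * r
def E (t : ℝ) : ℝ := ∫ r in (0:ℝ)..R, (S.ρ r t * S.u r t ^ 2 / 2 + S.P r t / (γ - 1)) * r
def Y (t : ℝ) : ℝ :=
  ∫ r in (0:ℝ)..R, ((2 * μ + S.L r t) * S.w r t ^ 2 / 2 - S.P r t * S.w r t) * r

lemma cud : Continuous (fun p : ℝ × ℝ => S.ud p.1 p.2) := by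
  have := S.cut; have := S.cu; have := S.cur
  unfold ud; fun_prop

lemma cF : ContinuousOn (fun p : ℝ × ℝ => S.F p.1 p.2) (Icc 0 R ×ˢ Icc 0 T) := by
  have := S.cL; have := S.cw; have := S.cP
  unfold F; fun_prop

lemma dF {r t : ℝ} (hr : r ∈ Icc 0 R) (ht : t ∈ Icc 0 T) :
    HasDerivAt (fun s => S.F s t) (S.ρ r t * S.ud r t) r := by
  have h := (((S.dLr r hr t ht).const_add (2 * μ)).mul (S.dwr r hr t ht)).sub (S.dPr r hr t ht)
  refine h.congr_deriv ?_
  rw [ud, ← S.mom r hr t ht]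

lemma P_pos {r t : ℝ} (hr : r ∈ Icc 0 R) (ht : t ∈ Icc 0 T) : 0 < S.P r t := by
  rw [S.hP]; exact Real.rpow_pos_of_pos (S.pos r hr t ht) _

lemma L_pos {r t : ℝ} (hr : r ∈ Icc 0 R) (ht : t ∈ Icc 0 T) : 0 < S.L r t := by
  rw [S.hL]; exact Real.rpow_pos_of_pos (S.pos r hr t ht) _

lemma bc0 {t : ℝ} (ht : t ∈ Icc 0 T) : S.u 0 t = 0 := by
  rw [S.hv 0 ⟨le_rfl, S.hR.le⟩ t ht, zero_mul]

lemma cE : ContinuousOn S.E (Icc 0 T) := by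
  have := S.cρ; have := S.cu; have := S.cP
  exact contOn_param S.hR.le S.hT.le
    (f := fun r t => (S.ρ r t * S.u r t ^ 2 / 2 + S.P r t / (γ - 1)) * r) (by fun_prop)

lemma cY : ContinuousOn S.Y (Icc 0 T) := by
  have := S.cw; have := S.cL; have := S.cP
  exact contOn_param S.hR.le S.hT.le
    (f := fun r t => ((2 * μ + S.L r t) * S.w r t ^ 2 / 2 - S.P r t * S.w r t) * r) (by fun_prop)

lemma dE {t : ℝ} (ht : t ∈ Ioo 0 T) : HasDerivAt S.E (-S.X t) t := by
  have htc := Ioo_subset_Icc_self ht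
  have c1 := S.cρ; have c2 := S.cu; have c3 := S.cP; have c4 := S.cρr; have c5 := S.cut
  have c6 := S.cPr; have c7 := S.cw; have c8 := S.cL; have c9 := S.cF; have c10 := S.cud
  have c11 := S.cur
  have hγ : γ - 1 ≠ 0 := by linarith [S.hγ]
  have hd := hasDerivAt_param (a := 0) (R := R) (T := T) S.hR.le
    (f := fun r t => (S.ρ r t * S.u r t ^ 2 / 2 + S.P r t / (γ - 1)) * r)
    (f' := fun r t => (((-(S.u r t * S.ρr r t) - S.ρ r t * S.w r t) * S.u r t ^ 2
      + S.ρ r t * (2 * S.u r t * S.ut r t)) / 2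
      + (-(S.u r t * S.Pr r t) - γ * S.P r t * S.w r t) / (γ - 1)) * r)
    (fun τ hτ => by
      have := slice hτ c3
      fun_prop) (by fun_prop)
    (fun r hr τ hτ => by
      have h := ((((S.dρt r hr τ hτ).mul ((S.dut r hr τ hτ).pow 2)).div_const 2).add
        ((S.dPt r hr τ hτ).div_const (γ - 1))).mul_const r
      refine h.congr_deriv ?_
      simp) ht
  refine hd.congr_deriv ?_
  have s3 := slice htc c3; have s6 := slice htc c6; have s8 := slice htc c8; have s9 := slice htc c9
  have hflux := intervalIntegral.integral_eq_sub_of_hasDerivAt_of_le S.hR.le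
    (f := fun r => r * S.u r t * S.F r t - r * S.ρ r t * S.u r t ^ 3 / 2
      - r * S.u r t * S.P r t / (γ - 1))
    (f' := fun r => (S.u r t + r * S.ur r t) * S.F r t + r * S.u r t * (S.ρ r t * S.ud r t)
      - ((S.ρ r t + r * S.ρr r t) * S.u r t ^ 3 + r * S.ρ r t * (3 * S.u r t ^ 2 * S.ur r t)) / 2
      - ((S.u r t + r * S.ur r t) * S.P r t + r * S.u r t * S.Pr r t) / (γ - 1))
    (by fun_prop)
    (fun r hr' => by
      have hr := Ioo_subset_Icc_self hr'
      have hi := hasDerivAt_id r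
      have h1 := (hi.mul (S.dur r hr t htc))
      have h2 := ((hi.mul (S.dρr r hr t htc)).mul ((S.dur r hr t htc).pow 3)).div_const 2
      have h3 := (h1.mul (S.dPr r hr t htc)).div_const (γ - 1)
      have h := ((h1.mul (S.dF hr htc)).sub h2).sub h3
      refine h.congr_deriv ?_
      simp)
    (ii_of S.hR.le (by fun_prop))
  simp only [S.bcR t htc] at hflux
  rw [X, ← intervalIntegral.integral_neg, ← sub_eq_zero,
    ← intervalIntegral.integral_sub (ii_of S.hR.le (by fun_prop)) (ii_of S.hR.le (by fun_prop))]
  have h0 : R * 0 * S.F R t - R * S.ρ R t * 0 ^ 3 / 2 - R * 0 * S.P R t / (γ - 1) -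
    (0 * S.u 0 t * S.F 0 t - 0 * S.ρ 0 t * S.u 0 t ^ 3 / 2 - 0 * S.u 0 t * S.P 0 t / (γ - 1))
      = 0 := by ring
  rw [h0] at hflux
  refine Eq.trans ?_ hflux
  refine intervalIntegral.integral_congr fun r hr => ?_
  rw [uIcc_of_le S.hR.le] at hr
  have e1 := S.hv r hr t htc
  have e2 : S.ur r t = S.w r t - S.v r t := by rw [S.hw r hr t htc]; ring
  simp only [F, ud, e2, e1]
  field_simp
  ring

lemma dY {t : ℝ} (ht : t ∈ Ioo 0 T) : HasDerivAt S.Y (∫ r in (0:ℝ)..R,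
    (-(S.ρ r t * S.ud r t ^ 2 * r) +
      ((2 * μ + S.L r t - β * S.L r t) * S.w r t ^ 3 / 2 + (γ - 1) * S.P r t * S.w r t ^ 2
        - S.F r t * S.w r t ^ 2) * r - S.u r t ^ 2 * (S.ρ r t * S.ud r t))) t := by
  have htc := Ioo_subset_Icc_self ht
  have c1 := S.cρ; have c2 := S.cu; have c3 := S.cP; have c4 := S.cρr; have c5 := S.cut
  have c6 := S.cPr; have c7 := S.cw; have c8 := S.cL; have c9 := S.cF; have c10 := S.cud
  have c11 := S.cur; have c12 := S.cLr; have c13 := S.cwt; have c14 := S.cwr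
  have hd := hasDerivAt_param (a := 0) (R := R) (T := T) S.hR.le
    (f := fun r t => ((2 * μ + S.L r t) * S.w r t ^ 2 / 2 - S.P r t * S.w r t) * r)
    (f' := fun r t => (((-(S.u r t * S.Lr r t) - β * S.L r t * S.w r t) * S.w r t ^ 2
      + (2 * μ + S.L r t) * (2 * S.w r t * S.wt r t)) / 2
      - ((-(S.u r t * S.Pr r t) - γ * S.P r t * S.w r t) * S.w r t + S.P r t * S.wt r t)) * r)
    (fun τ hτ => by
      have := slice hτ c3; have := slice hτ c8
      fun_prop) (by fun_prop)
    (fun r hr τ hτ => by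
      have h := (((((S.dLt r hr τ hτ).const_add (2 * μ)).mul
        ((S.dwt r hr τ hτ).pow 2)).div_const 2).sub
        ((S.dPt r hr τ hτ).mul (S.dwt r hr τ hτ))).mul_const r
      refine h.congr_deriv ?_
      simp) ht
  refine hd.congr_deriv ?_
  have s3 := slice htc c3; have s6 := slice htc c6; have s8 := slice htc c8
  have s9 := slice htc c9; have s12 := slice htc c12
  have hflux := intervalIntegral.integral_eq_sub_of_hasDerivAt_of_le S.hR.le
    (f := fun r => r * S.ut r t * S.F r t -
      r * S.u r t * ((2 * μ + S.L r t) * S.w r t ^ 2 / 2 - S.P r t * S.w r t)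
      + r * S.u r t * (S.w r t * S.F r t))
    (f' := fun r => r * S.wt r t * S.F r t + r * S.ut r t * (S.ρ r t * S.ud r t)
      - ((S.u r t + r * S.ur r t) * ((2 * μ + S.L r t) * S.w r t ^ 2 / 2 - S.P r t * S.w r t)
        + r * S.u r t * ((S.Lr r t * S.w r t ^ 2 + (2 * μ + S.L r t) * (2 * S.w r t * S.wr r t)) / 2
          - (S.Pr r t * S.w r t + S.P r t * S.wr r t)))
      + ((S.u r t + r * S.ur r t) * (S.w r t * S.F r t) + r * S.u r t *
        (S.wr r t * S.F r t + S.w r t * (S.ρ r t * S.ud r t))))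
    (by fun_prop)
    (fun r hr' => by
      have hr := Ioo_subset_Icc_self hr'
      have hi := hasDerivAt_id r
      have h1 := (hi.mul (S.dur r hr t htc))
      have h2 := ((((S.dLr r hr t htc).const_add (2 * μ)).mul
        ((S.dwr r hr t htc).pow 2)).div_const 2).sub
        ((S.dPr r hr t htc).mul (S.dwr r hr t htc))
      have h3 := (S.dru r hr t htc).mul (S.dF hr htc)
      have h4 := (S.dwr r hr t htc).mul (S.dF hr htc)
      have h := (h3.sub (h1.mul h2)).add (h1.mul h4)
      refine h.congr_deriv ?_
      simp)
    (ii_of S.hR.le (by fun_prop))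
  simp only [S.bcR t htc, S.bcRt t htc] at hflux
  rw [← sub_eq_zero,
    ← intervalIntegral.integral_sub (ii_of S.hR.le (by fun_prop)) (ii_of S.hR.le (by fun_prop))]
  have h0 : R * 0 * S.F R t -
      R * 0 * ((2 * μ + S.L R t) * S.w R t ^ 2 / 2 - S.P R t * S.w R t)
      + R * 0 * (S.w R t * S.F R t) - (0 * S.ut 0 t * S.F 0 t -
      0 * S.u 0 t * ((2 * μ + S.L 0 t) * S.w 0 t ^ 2 / 2 - S.P 0 t * S.w 0 t)
      + 0 * S.u 0 t * (S.w 0 t * S.F 0 t)) = 0 := by ring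
  rw [h0] at hflux
  refine Eq.trans ?_ hflux
  refine intervalIntegral.integral_congr fun r hr => ?_
  rw [uIcc_of_le S.hR.le] at hr
  have e1 := S.hv r hr t htc
  have e2 : S.ur r t = S.w r t - S.v r t := by rw [S.hw r hr t htc]; ring
  have e3 : S.ut r t = S.ud r t - S.u r t * S.ur r t := by rw [ud]; ring
  simp only [e3, F]
  simp only [e2, e1]
  ring

/-- `‖∇u‖² = ‖div u‖²`. -/
lemma grad_eq {t : ℝ} (ht : t ∈ Icc 0 T) :
    ∫ r in (0:ℝ)..R, (S.ur r t ^ 2 + S.v r t ^ 2) * r = S.W t := by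
  have c2 := S.cu; have c7 := S.cw; have c11 := S.cur; have c12 := S.cv
  have hflux := intervalIntegral.integral_eq_sub_of_hasDerivAt_of_le S.hR.le
    (f := fun r => S.u r t ^ 2)
    (f' := fun r => 2 * S.u r t * S.ur r t) (by fun_prop)
    (fun r hr' => by
      refine ((S.dur r (Ioo_subset_Icc_self hr') t ht).pow 2).congr_deriv (by simp))
    (ii_of S.hR.le (by fun_prop))
  simp only [S.bcR t ht, S.bc0 ht, sub_self] at hflux
  rw [W, eq_comm, ← sub_eq_zero,
    ← intervalIntegral.integral_sub (ii_of S.hR.le (by fun_prop)) (ii_of S.hR.le (by fun_prop))]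
  refine Eq.trans ?_ (hflux.trans (by ring))
  refine intervalIntegral.integral_congr fun r hr => ?_
  rw [uIcc_of_le S.hR.le] at hr
  simp only [S.hv r hr t ht, S.hw r hr t ht]
  ring

lemma v_le {t : ℝ} (ht : t ∈ Icc 0 T) : ∫ r in (0:ℝ)..R, S.v r t ^ 2 * r ≤ S.W t := by
  have c11 := S.cur; have c12 := S.cv
  rw [← S.grad_eq ht]
  refine int_mono S.hR.le (by fun_prop) (by fun_prop) fun r hr => ?_
  exact mul_le_mul_of_nonneg_right (by nlinarith [sq_nonneg (S.ur r t)]) hr.1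

lemma u_sq_le {r t : ℝ} (hr : r ∈ Icc 0 R) (ht : t ∈ Icc 0 T) : S.u r t ^ 2 ≤ S.W t := by
  have c2 := S.cu; have c7 := S.cw; have c11 := S.cur; have c12 := S.cv
  have hflux := intervalIntegral.integral_eq_sub_of_hasDerivAt_of_le hr.1
    (f := fun r => S.u r t ^ 2)
    (f' := fun r => 2 * S.u r t * S.ur r t) (by fun_prop)
    (fun s hs => by
      refine ((S.dur s ⟨hs.1.le, hs.2.le.trans hr.2⟩ t ht).pow 2).congr_deriv (by simp))
    (ContinuousOn.intervalIntegrable_of_Icc hr.1 (by fun_prop))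
  simp only [S.bc0 ht] at hflux
  have : S.u r t ^ 2 = ∫ s in (0:ℝ)..r, 2 * S.u s t * S.ur s t := by rw [hflux]; ring
  rw [this, ← S.grad_eq ht]
  refine int_le_of_bound S.hR.le ⟨le_rfl, S.hR.le⟩ hr (by fun_prop) (by fun_prop) ?_ ?_
  · intro s hs
    rw [S.hv s hs t ht]
    nlinarith [mul_nonneg hs.1 (sq_nonneg (S.ur s t - S.v s t))]
  · intro s hs
    have := hs.1
    positivity

lemma W_nonneg (t : ℝ) : 0 ≤ S.W t :=
  int_nonneg S.hR.le fun r hr => mul_nonneg (sq_nonneg _) hr.1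

lemma W_le {t : ℝ} (ht : t ∈ Icc 0 T) : 2 * μ * S.W t ≤ S.X t := by
  have c7 := S.cw; have c8 := slice ht S.cL
  rw [W, X, ← intervalIntegral.integral_const_mul]
  refine int_mono S.hR.le (by fun_prop) (by fun_prop) fun r hr => ?_
  rw [← mul_assoc]
  refine mul_le_mul_of_nonneg_right (mul_le_mul_of_nonneg_right ?_ (sq_nonneg _)) hr.1
  linarith [S.L_pos hr ht]

lemma X_nonneg {t : ℝ} (ht : t ∈ Icc 0 T) : 0 ≤ S.X t :=
  (mul_nonneg (by linarith [S.hμ]) (S.W_nonneg t)).trans (S.W_le ht)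

lemma B2_nonneg {t : ℝ} (ht : t ∈ Icc 0 T) : 0 ≤ S.B2 t :=
  int_nonneg S.hR.le fun r hr =>
    mul_nonneg (mul_nonneg (S.pos r hr t ht).le (sq_nonneg _)) hr.1

lemma E_nonneg {t : ℝ} (ht : t ∈ Icc 0 T) : 0 ≤ S.E t :=
  int_nonneg S.hR.le fun r hr => by
    have := S.pos r hr t ht; have := S.P_pos hr ht; have := S.hγ; have := hr.1
    have : 0 < γ - 1 := by linarith
    positivity

lemma E_anti : AntitoneOn S.E (Icc 0 T) := by
  apply antitoneOn_of_deriv_nonpos (convex_Icc 0 T) S.cE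
  · intro t ht
    rw [interior_Icc] at ht
    exact (S.dE ht).differentiableAt.differentiableWithinAt
  · intro t ht
    rw [interior_Icc] at ht
    rw [(S.dE ht).deriv]
    linarith [S.X_nonneg (Ioo_subset_Icc_self ht)]

lemma E_le {t : ℝ} (ht : t ∈ Icc 0 T) : S.E t ≤ S.E 0 :=
  S.E_anti ⟨le_rfl, S.hT.le⟩ ht ht.1

end Sol

set_option maxHeartbeats 1600000 in
lemma numeric_bound {N Nβ Nd Ng B X W f b q I D K1 K2 K3 c1 : ℝ}
    (hN : 1 ≤ N) (hNβ : 1 ≤ Nβ) (hNd : 1 ≤ Nd) (hNg : 1 ≤ Ng) (hB : 0 ≤ B) (hX : 0 ≤ X)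
    (hW : 0 ≤ W) (hf0 : 0 ≤ f) (hb0 : 0 ≤ b) (hK1 : 0 ≤ K1) (hK2 : 0 ≤ K2) (hK3 : 0 ≤ K3)
    (hc1 : 0 ≤ c1) (hd : Nd ^ 2 * N ≤ Nβ) (hgb : Nβ ≤ Ng ^ 2) (hNNβ : N ≤ Nβ)
    (hI : I ≤ (Nd * q + Ng) * W + K1 * q * f / Ng ^ 2)
    (hf : f ≤ K2 * (Nβ * X + Ng ^ 2)) (hb : b ≤ N * B) (hq : q = √(b + f)) (hWX : W ≤ K3 * X)
    (hD : D ≤ -B / 2 + c1 * I + c1 * Ng * W + N * W ^ 2 / 2) :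
    D ≤ ((c1 * (K3 + K1 * K2)) ^ 2 + c1 * (K3 + K1 * K2) * (K2 + 1) + 2 * c1 * K3 + K3 ^ 2)
      * Nβ * (1 + X) * (X + Ng ^ 2) := by
  set G := Ng ^ 2 with hG
  have hG1 : 1 ≤ G := by nlinarith
  have hNgG : Ng ≤ G := by nlinarith
  have hy0 := Real.sqrt_nonneg (N * B)
  have hz0 := Real.sqrt_nonneg f
  set y := √(N * B) with hy
  set z := √f with hz
  have hysq : y ^ 2 = N * B := Real.sq_sqrt (by positivity)
  have hzsq : z ^ 2 = f := Real.sq_sqrt hf0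
  have hq0 : 0 ≤ q := by rw [hq]; exact Real.sqrt_nonneg _
  have hqyz : q ≤ y + z := by
    rw [hq, Real.sqrt_le_iff]
    refine ⟨by positivity, ?_⟩
    nlinarith [mul_nonneg hy0 hz0]
  have hfG : f / G ≤ K2 * (X + 1) := by
    rw [div_le_iff₀ (by linarith)]
    refine hf.trans ?_
    have : Nβ * X + G ≤ (X + 1) * G := by linarith [mul_le_mul_of_nonneg_right hgb hX]
    linarith [mul_le_mul_of_nonneg_left this hK2]
  set K4 := K3 + K1 * K2 with hK4
  have hK40 : 0 ≤ K4 := by positivity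
  have hI2 : I ≤ K4 * (Nd * q * (X + 1)) + Ng * K3 * X := by
    have i1 : (Nd * q + Ng) * W ≤ (Nd * q + Ng) * (K3 * X) :=
      mul_le_mul_of_nonneg_left hWX (by positivity)
    have i2 : K1 * q * f / G ≤ K1 * K2 * (Nd * q * (X + 1)) := by
      have : K1 * q * f / G = K1 * q * (f / G) := by ring
      rw [this]
      have h1 : K1 * q * (f / G) ≤ K1 * q * (K2 * (X + 1)) :=
        mul_le_mul_of_nonneg_left hfG (by positivity)
      have h2 : K1 * q * (K2 * (X + 1)) ≤ Nd * (K1 * q * (K2 * (X + 1))) :=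
        le_mul_of_one_le_left (by positivity) hNd
      linarith
    have i3 : 0 ≤ K3 * (Nd * q) := by positivity
    rw [hK4]
    linarith
  set U := Nβ * (1 + X) * (X + G) with hU
  have hXG : 1 ≤ X + G := by linarith
  have hX1 : 1 ≤ 1 + X := by linarith
  -- y part
  have hyp : c1 * K4 * (Nd * y * (X + 1)) ≤ B / 2 + (c1 * K4) ^ 2 * U := by
    have hsN := Real.sqrt_nonneg N
    have hsB := Real.sqrt_nonneg B
    have e : y = √N * √B := by rw [hy, Real.sqrt_mul (by linarith)]
    have e1 : √N ^ 2 = N := Real.sq_sqrt (by linarith)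
    have e2 : √B ^ 2 = B := Real.sq_sqrt hB
    set p := c1 * K4 * (X + 1) * Nd * √N with hp
    have h1 : c1 * K4 * (Nd * y * (X + 1)) = p * √B := by rw [e, hp]; ring
    have h2 : p ^ 2 = (c1 * K4) ^ 2 * ((X + 1) ^ 2 * (Nd ^ 2 * N)) := by
      have : p ^ 2 = (c1 * K4) ^ 2 * ((X + 1) ^ 2 * (Nd ^ 2 * √N ^ 2)) := by rw [hp]; ring
      rw [this, e1]
    have h3 : (X + 1) ^ 2 * (Nd ^ 2 * N) ≤ U := by
      have a1 : (X + 1) ^ 2 * (Nd ^ 2 * N) ≤ (X + 1) ^ 2 * Nβ :=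
        mul_le_mul_of_nonneg_left hd (by positivity)
      have a2 : (X + 1) ^ 2 * Nβ ≤ U := by
        rw [hU]
        have : Nβ * (1 + X) * (X + 1) ≤ Nβ * (1 + X) * (X + G) :=
          mul_le_mul_of_nonneg_left (by linarith) (by positivity)
        linarith
      linarith
    have h4 := mul_le_mul_of_nonneg_left h3 (sq_nonneg (c1 * K4))
    have hUn : 0 ≤ U := by positivity
    have h5 : 0 ≤ (c1 * K4) ^ 2 * U := by positivity
    have h6 := sq_nonneg (p - √B)
    have h7 : (p - √B) ^ 2 = p ^ 2 - 2 * (p * √B) + √B ^ 2 := by ring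
    rw [h7, e2, h2] at h6
    rw [h1]
    linarith
  have hzp : Nd * z ≤ (K2 + 1) * (Nβ * (X + G)) := by
    apply abs_le_of_sq_le_sq' _ (by positivity) |>.2
    have a1 : (Nd * z) ^ 2 = Nd ^ 2 * f := by rw [mul_pow, hzsq]
    have a0 : Nd ^ 2 ≤ Nβ := (le_mul_of_one_le_right (sq_nonneg Nd) hN).trans hd
    have a2 : Nd ^ 2 * f ≤ Nβ * (K2 * (Nβ * X + G)) :=
      mul_le_mul a0 hf hf0 (by linarith)
    have a3 : Nβ * X + G ≤ Nβ * (X + G) := by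
      have := le_mul_of_one_le_left (by linarith : 0 ≤ G) hNβ
      linarith
    have a4 : Nβ * (K2 * (Nβ * X + G)) ≤ K2 * (Nβ ^ 2 * (X + G)) := by
      have := mul_le_mul_of_nonneg_left a3 (by positivity : 0 ≤ Nβ * K2)
      linarith
    have a5 : Nβ ^ 2 * (X + G) ≤ (Nβ * (X + G)) ^ 2 := by
      rw [mul_pow]
      exact mul_le_mul_of_nonneg_left (by rw [sq]; exact le_mul_of_one_le_left (by linarith) hXG) (by positivity)
    have a6 := mul_le_mul_of_nonneg_left a5 hK2
    rw [a1, mul_pow]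
    have a7 : K2 * (Nβ * (X + G)) ^ 2 ≤ (K2 + 1) ^ 2 * (Nβ * (X + G)) ^ 2 :=
      mul_le_mul_of_nonneg_right (by linarith [sq_nonneg K2, (by ring : (K2 + 1) ^ 2 = K2 ^ 2 + 2 * K2 + 1)]) (sq_nonneg _)
    linarith
  have hzp2 : c1 * K4 * (Nd * z * (X + 1)) ≤ c1 * K4 * (K2 + 1) * U := by
    have := mul_le_mul_of_nonneg_left hzp (by positivity : 0 ≤ c1 * K4 * (X + 1))
    rw [hU]; linarith
  have hNgX : Ng * X ≤ U := by
    have h1 : Ng * X ≤ (X + G) * (1 + X) :=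
      mul_le_mul (by linarith) (by linarith) hX (by linarith)
    have h2 : (X + G) * (1 + X) ≤ Nβ * ((X + G) * (1 + X)) :=
      le_mul_of_one_le_left (by positivity) hNβ
    rw [hU]; linarith
  have hNW : N * W ^ 2 / 2 ≤ K3 ^ 2 * U := by
    have h1 : W ^ 2 ≤ (K3 * X) ^ 2 := pow_le_pow_left₀ hW hWX 2
    have h2 : N * X ^ 2 ≤ U := by
      have : N * X ^ 2 ≤ Nβ * ((1 + X) * (X + G)) :=
        mul_le_mul hNNβ (by rw [sq]; exact mul_le_mul (by linarith) (by linarith) hX (by linarith)) (sq_nonneg _) (by linarith)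
      rw [hU]; linarith
    have h3 := mul_le_mul_of_nonneg_left h1 (by linarith : 0 ≤ N)
    have h4 := mul_le_mul_of_nonneg_left h2 (sq_nonneg K3)
    have h5 : 0 ≤ N * W ^ 2 := by positivity
    linarith
  have hqsplit : c1 * K4 * (Nd * q * (X + 1)) ≤
      c1 * K4 * (Nd * y * (X + 1)) + c1 * K4 * (Nd * z * (X + 1)) := by
    have := mul_le_mul_of_nonneg_left hqyz (by positivity : 0 ≤ c1 * K4 * (Nd * (X + 1)))
    linarith
  have hcI := mul_le_mul_of_nonneg_left hI2 hc1
  have hcW : c1 * Ng * W ≤ c1 * Ng * (K3 * X) := mul_le_mul_of_nonneg_left hWX (by positivity)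
  have hcX := mul_le_mul_of_nonneg_left hNgX (by positivity : 0 ≤ c1 * K3)
  have : ((c1 * K4) ^ 2 + c1 * K4 * (K2 + 1) + 2 * c1 * K3 + K3 ^ 2) * Nβ * (1 + X) * (X + G)
    = (c1 * K4) ^ 2 * U + c1 * K4 * (K2 + 1) * U + 2 * (c1 * K3 * U) + K3 ^ 2 * U := by
    rw [hU]; ring
  rw [this]
  linarith

namespace Sol

variable {μ β γ R T : ℝ} (S : Sol μ β γ R T)

lemma L_le {N r t : ℝ} (hr : r ∈ Icc 0 R) (ht : t ∈ Icc 0 T)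
    (h : S.ρ r t ≤ N) : S.L r t ≤ N ^ β := by
  rw [S.hL]
  exact Real.rpow_le_rpow (S.pos r hr t ht).le h (by linarith [S.hβ])

lemma P_le {N r t : ℝ} (hr : r ∈ Icc 0 R) (ht : t ∈ Icc 0 T)
    (h : S.ρ r t ≤ N) : S.P r t ≤ N ^ γ := by
  rw [S.hP]
  exact Real.rpow_le_rpow (S.pos r hr t ht).le h (by linarith [S.hγ])

lemma int_r (hR : 0 ≤ R) : ∫ r in (0:ℝ)..R, r = R ^ 2 / 2 := by
  simp

lemma f_bound {N t : ℝ} (hN : 1 ≤ N) (ht : t ∈ Icc 0 T) (hρ : ∀ r ∈ Icc 0 R, S.ρ r t ≤ N) :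
    ∫ r in (0:ℝ)..R, S.F r t ^ 2 * r ≤
      (2 * (2 * μ + 1) + R ^ 2) * (N ^ β * S.X t + (N ^ γ) ^ 2) := by
  have c7 := S.cw; have c8 := slice ht S.cL; have c9 := slice ht S.cF
  have hNβ : 1 ≤ N ^ β := Real.one_le_rpow hN (by linarith [S.hβ])
  have hμ := S.hμ
  have hX := S.X_nonneg ht
  have h1 : ∫ r in (0:ℝ)..R, S.F r t ^ 2 * r ≤ ∫ r in (0:ℝ)..R,
      ((2 * (2 * μ + 1) * N ^ β) * ((2 * μ + S.L r t) * S.w r t ^ 2 * r)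
        + (2 * (N ^ γ) ^ 2) * r) := by
    refine int_mono S.hR.le (by fun_prop) (by fun_prop) fun r hr => ?_
    have hL := S.L_le hr ht (hρ r hr)
    have hP := S.P_le hr ht (hρ r hr)
    have hL0 := S.L_pos hr ht
    have hP0 := S.P_pos hr ht
    have a1 : S.F r t ^ 2 ≤ 2 * ((2 * μ + S.L r t) * S.w r t) ^ 2 + 2 * (N ^ γ) ^ 2 := by
      have : S.P r t ^ 2 ≤ (N ^ γ) ^ 2 := pow_le_pow_left₀ hP0.le hP 2
      unfold F
      nlinarith [sq_nonneg ((2 * μ + S.L r t) * S.w r t + S.P r t)]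
    have a2 : 2 * μ + S.L r t ≤ (2 * μ + 1) * N ^ β := by nlinarith
    have a3 : ((2 * μ + S.L r t) * S.w r t) ^ 2 ≤
        (2 * μ + 1) * N ^ β * ((2 * μ + S.L r t) * S.w r t ^ 2) := by
      have : ((2 * μ + S.L r t) * S.w r t) ^ 2
        = (2 * μ + S.L r t) * ((2 * μ + S.L r t) * S.w r t ^ 2) := by ring
      rw [this]
      exact mul_le_mul_of_nonneg_right a2 (by positivity)
    have a4 := mul_le_mul_of_nonneg_right
      (a1.trans (by linarith : _ ≤ 2 * ((2 * μ + 1) * N ^ β * ((2 * μ + S.L r t) * S.w r t ^ 2))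
        + 2 * (N ^ γ) ^ 2)) hr.1
    nlinarith
  refine h1.trans ?_
  rw [intervalIntegral.integral_add (ii_of S.hR.le (by fun_prop)) (ii_of S.hR.le (by fun_prop)),
    intervalIntegral.integral_const_mul, intervalIntegral.integral_const_mul, int_r S.hR.le]
  change 2 * (2 * μ + 1) * N ^ β * S.X t + _ ≤ _
  have p1 : 0 ≤ R ^ 2 * (N ^ β * S.X t) := by positivity
  have p2 : 0 ≤ 2 * (2 * μ + 1) * (N ^ γ) ^ 2 := by positivity
  nlinarith

lemma b_bound {N t : ℝ} (ht : t ∈ Icc 0 T) (hρ : ∀ r ∈ Icc 0 R, S.ρ r t ≤ N) :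
    ∫ r in (0:ℝ)..R, (S.ρ r t * S.ud r t) ^ 2 * r ≤ N * S.B2 t := by
  have c7 := S.cρ; have c8 := S.cud
  rw [B2, ← intervalIntegral.integral_const_mul]
  refine int_mono S.hR.le (by fun_prop) (by fun_prop) fun r hr => ?_
  have h := S.pos r hr t ht
  have := mul_le_mul_of_nonneg_right (hρ r hr)
    (mul_nonneg (mul_nonneg h.le (sq_nonneg (S.ud r t))) hr.1)
  nlinarith

set_option maxHeartbeats 1600000 in
lemma D_bound {N t : ℝ} (ht : t ∈ Icc 0 T) (hρ : ∀ r ∈ Icc 0 R, S.ρ r t ≤ N) :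
    (∫ r in (0:ℝ)..R,
    (-(S.ρ r t * S.ud r t ^ 2 * r) +
      ((2 * μ + S.L r t - β * S.L r t) * S.w r t ^ 3 / 2 + (γ - 1) * S.P r t * S.w r t ^ 2
        - S.F r t * S.w r t ^ 2) * r - S.u r t ^ 2 * (S.ρ r t * S.ud r t))) ≤
    - S.B2 t / 2 + (1 + β + γ) * (∫ r in (0:ℝ)..R, |S.F r t| * S.w r t ^ 2 * r)
      + (1 + β + γ) * N ^ γ * S.W t + N * S.W t ^ 2 / 2 := by
  have c1 := S.cρ; have c2 := S.cu; have c3 := slice ht S.cP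
  have c7 := S.cw; have c8 := slice ht S.cL; have c9 := slice ht S.cF; have c10 := S.cud
  have c12 := S.cv
  have hμ := S.hμ; have hβ := S.hβ; have hγ := S.hγ
  have hWn := S.W_nonneg t
  have hN0 : 0 < N := (S.pos 0 ⟨le_rfl, S.hR.le⟩ t ht).trans_le (hρ 0 ⟨le_rfl, S.hR.le⟩)
  calc _ ≤ ∫ r in (0:ℝ)..R, (-1 / 2 * (S.ρ r t * S.ud r t ^ 2 * r)
      + (1 + β + γ) * (|S.F r t| * S.w r t ^ 2 * r)
      + (1 + β + γ) * N ^ γ * (S.w r t ^ 2 * r) + N * S.W t / 2 * (S.v r t ^ 2 * r)) := by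
        refine int_mono S.hR.le (by fun_prop) (by fun_prop) fun r hr => ?_
        have hρ0 := S.pos r hr t ht
        have hP := S.P_le hr ht (hρ r hr)
        have hL0 := S.L_pos hr ht
        have hP0 := S.P_pos hr ht
        have hr0 := hr.1
        have hus := S.u_sq_le hr ht
        have huv := S.hv r hr t ht
        have g1 : -(S.u r t ^ 2 * (S.ρ r t * S.ud r t)) ≤
            1 / 2 * (S.ρ r t * S.ud r t ^ 2 * r) + N * S.W t / 2 * (S.v r t ^ 2 * r) := by
          have e1 : S.u r t ^ 2 * (S.ρ r t * S.ud r t)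
            = (S.ρ r t * r) * ((S.u r t * S.v r t) * S.ud r t) := by rw [huv]; ring
          have e2 : (S.ρ r t * r) * (S.u r t * S.v r t) ^ 2 ≤ N * S.W t * (S.v r t ^ 2 * r) := by
            have : S.ρ r t * S.u r t ^ 2 ≤ N * S.W t :=
              mul_le_mul (hρ r hr) hus (sq_nonneg _) hN0.le
            have := mul_le_mul_of_nonneg_right this
              (by positivity : 0 ≤ S.v r t ^ 2 * r)
            nlinarith
          rw [e1]
          nlinarith [mul_nonneg (mul_nonneg hρ0.le hr0)
            (sq_nonneg (S.u r t * S.v r t + S.ud r t))]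
        have g2 : (2 * μ + S.L r t - β * S.L r t) * S.w r t ^ 3 / 2 ≤
            (1 + β) / 2 * ((|S.F r t| + S.P r t) * S.w r t ^ 2) := by
          have e1 : (2 * μ + S.L r t) * |S.w r t| ≤ |S.F r t| + S.P r t := by
            have : (2 * μ + S.L r t) * |S.w r t| = |S.F r t + S.P r t| := by
              unfold F
              rw [sub_add_cancel, abs_mul, abs_of_pos (by positivity : 0 < 2 * μ + S.L r t)]
            rw [this]
            refine (abs_add_le _ _).trans ?_
            rw [abs_of_pos hP0]
          have e2 : |2 * μ + S.L r t - β * S.L r t| ≤ (1 + β) * (2 * μ + S.L r t) := by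
            rw [abs_le]; constructor <;> nlinarith
          have e3 : (2 * μ + S.L r t - β * S.L r t) * S.w r t ^ 3 ≤
              |2 * μ + S.L r t - β * S.L r t| * |S.w r t| * S.w r t ^ 2 := by
            refine (le_abs_self _).trans (le_of_eq ?_)
            rw [abs_mul, abs_pow, ← sq_abs (S.w r t)]; ring
          have e4 : |2 * μ + S.L r t - β * S.L r t| * |S.w r t| ≤
              (1 + β) * (|S.F r t| + S.P r t) := by
            calc _ ≤ (1 + β) * (2 * μ + S.L r t) * |S.w r t| :=
                  mul_le_mul_of_nonneg_right e2 (abs_nonneg _)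
              _ = (1 + β) * ((2 * μ + S.L r t) * |S.w r t|) := by ring
              _ ≤ _ := mul_le_mul_of_nonneg_left e1 (by linarith)
          have e5 := mul_le_mul_of_nonneg_right e4 (sq_nonneg (S.w r t))
          linarith
        have g3 : -(S.F r t * S.w r t ^ 2) ≤ |S.F r t| * S.w r t ^ 2 := by
          have := mul_le_mul_of_nonneg_right (neg_le_abs (S.F r t)) (sq_nonneg (S.w r t))
          linarith
        have g4 : S.P r t * S.w r t ^ 2 ≤ N ^ γ * S.w r t ^ 2 :=
          mul_le_mul_of_nonneg_right hP (sq_nonneg _)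
        have hFw : 0 ≤ |S.F r t| * S.w r t ^ 2 := by positivity
        have hPw : 0 ≤ S.P r t * S.w r t ^ 2 := by positivity
        have g5 : (2 * μ + S.L r t - β * S.L r t) * S.w r t ^ 3 / 2
            + (γ - 1) * S.P r t * S.w r t ^ 2 - S.F r t * S.w r t ^ 2 ≤
            (1 + β + γ) * (|S.F r t| * S.w r t ^ 2) + (1 + β + γ) * (N ^ γ * S.w r t ^ 2) := by
          have k1 : (1 + β + γ) * (S.P r t * S.w r t ^ 2) ≤ (1 + β + γ) * (N ^ γ * S.w r t ^ 2) :=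
            mul_le_mul_of_nonneg_left g4 (by linarith)
          have k2 : (1 + β) / 2 * (|S.F r t| * S.w r t ^ 2) + |S.F r t| * S.w r t ^ 2 ≤
              (1 + β + γ) * (|S.F r t| * S.w r t ^ 2) := by nlinarith
          have k3 : (1 + β) / 2 * (S.P r t * S.w r t ^ 2) + (γ - 1) * (S.P r t * S.w r t ^ 2) ≤
              (1 + β + γ) * (S.P r t * S.w r t ^ 2) := by nlinarith
          linarith
        have g6 := mul_le_mul_of_nonneg_right g5 hr0
        linarith
    _ = -1 / 2 * S.B2 t + (1 + β + γ) * (∫ r in (0:ℝ)..R, |S.F r t| * S.w r t ^ 2 * r)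
      + (1 + β + γ) * N ^ γ * S.W t + N * S.W t / 2 * ∫ r in (0:ℝ)..R, S.v r t ^ 2 * r := by
        rw [intervalIntegral.integral_add (ii_of S.hR.le (by fun_prop)) (ii_of S.hR.le (by fun_prop)),
          intervalIntegral.integral_add (ii_of S.hR.le (by fun_prop)) (ii_of S.hR.le (by fun_prop)),
          intervalIntegral.integral_add (ii_of S.hR.le (by fun_prop)) (ii_of S.hR.le (by fun_prop))]
        simp only [intervalIntegral.integral_const_mul, W, B2]
    _ ≤ _ := by
        have := mul_le_mul_of_nonneg_left (S.v_le ht) (by positivity : 0 ≤ N * S.W t / 2)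
        linarith

end Sol

lemma Fw_bound {μ β γ R : ℝ} (hμ : 0 < μ) (hβ : 1 < β) (hγ : 1 < γ) (hR : 0 < R) :
    ∃ K1 > 0, ∀ T : ℝ, ∀ S : Sol μ β γ R T, ∀ N t : ℝ, 1 ≤ N → t ∈ Icc 0 T →
      (∀ r ∈ Icc 0 R, S.ρ r t ≤ N) →
      ∫ r in (0:ℝ)..R, |S.F r t| * S.w r t ^ 2 * r ≤
      (N ^ ((β - 1) / 2) * √((∫ r in (0:ℝ)..R, (S.ρ r t * S.ud r t) ^ 2 * r)
        + ∫ r in (0:ℝ)..R, S.F r t ^ 2 * r) + N ^ γ) * S.W t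
      + K1 * √((∫ r in (0:ℝ)..R, (S.ρ r t * S.ud r t) ^ 2 * r)
        + ∫ r in (0:ℝ)..R, S.F r t ^ 2 * r) * (∫ r in (0:ℝ)..R, S.F r t ^ 2 * r) / (N ^ γ) ^ 2 := by
  obtain ⟨n, hn⟩ := exists_nat_ge (2 * γ / (β - 1))
  have hβ1 : 0 < β - 1 := by linarith
  rw [div_le_iff₀ hβ1] at hn
  obtain ⟨C, hC, hgn⟩ := gn hR (n + 1)
  refine ⟨C / μ ^ 2, by positivity, fun T S N t hN ht hρ => ?_⟩
  have c1 := S.cρ; have c7 := S.cw; have c9 := slice ht S.cF; have c10 := S.cud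
  have hg := hgn (fun r => S.F r t) (fun r => S.ρ r t * S.ud r t) (fun r hr => S.dF hr ht)
    (by fun_prop)
  set b := ∫ r in (0:ℝ)..R, (S.ρ r t * S.ud r t) ^ 2 * r with hb
  set f := ∫ r in (0:ℝ)..R, S.F r t ^ 2 * r with hf
  have hbn : 0 ≤ b := int_nonneg hR.le fun r hr => mul_nonneg (sq_nonneg _) hr.1
  have hfn : 0 ≤ f := int_nonneg hR.le fun r hr => mul_nonneg (sq_nonneg _) hr.1
  have hq0 := Real.sqrt_nonneg (b + f)
  have hqsq : √(b + f) ^ 2 = b + f := Real.sq_sqrt (by positivity)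
  set q := √(b + f) with hq
  have hN0 : 0 < N := by linarith
  have hNg : 1 ≤ N ^ γ := Real.one_le_rpow hN (by linarith)
  have hNd : 1 ≤ N ^ ((β - 1) / 2) := Real.one_le_rpow hN (by linarith)
  have hpow : (N ^ γ) ^ 2 ≤ (N ^ ((β - 1) / 2)) ^ (2 * n + 1) := by
    rw [← Real.rpow_natCast, ← Real.rpow_natCast, ← Real.rpow_mul hN0.le, ← Real.rpow_mul hN0.le]
    apply Real.rpow_le_rpow_of_exponent_le hN
    push_cast
    nlinarith
  set Ng := N ^ γ
  set Nd := N ^ ((β - 1) / 2)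
  set s := Nd * q + Ng with hs
  have hs0 : 0 < s := by positivity
  have h1 : ∫ r in (0:ℝ)..R, |S.F r t| * S.w r t ^ 2 * r ≤
      ∫ r in (0:ℝ)..R, (s * (S.w r t ^ 2 * r)
        + 1 / (μ ^ 2 * s ^ (2 * n + 1)) * ((S.F r t ^ (n + 1 + 1)) ^ 2 * r)) := by
    refine int_mono hR.le (by fun_prop) (by fun_prop) fun r hr => ?_
    have hr0 := hr.1
    have key : |S.F r t| * S.w r t ^ 2 ≤ s * S.w r t ^ 2
        + 1 / (μ ^ 2 * s ^ (2 * n + 1)) * (S.F r t ^ (n + 1 + 1)) ^ 2 := by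
      by_cases hc : |S.F r t| ≤ s
      · have := mul_le_mul_of_nonneg_right hc (sq_nonneg (S.w r t))
        have h0 : 0 ≤ 1 / (μ ^ 2 * s ^ (2 * n + 1)) * (S.F r t ^ (n + 1 + 1)) ^ 2 := by positivity
        linarith
      · push Not at hc
        have hP := S.P_le hr ht (hρ r hr)
        have hP0 := S.P_pos hr ht
        have hL0 := S.L_pos hr ht
        have hPs : S.P r t ≤ |S.F r t| := by
          have : 0 ≤ Nd * q := by positivity
          have : S.P r t ≤ Ng := hP
          linarith
        have hw : μ * |S.w r t| ≤ |S.F r t| := by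
          have e : (2 * μ + S.L r t) * |S.w r t| = |S.F r t + S.P r t| := by
            unfold Sol.F
            rw [sub_add_cancel, abs_mul, abs_of_pos (by positivity : 0 < 2 * μ + S.L r t)]
          have e2 := abs_add_le (S.F r t) (S.P r t)
          rw [abs_of_pos hP0] at e2
          nlinarith [abs_nonneg (S.w r t), mul_nonneg hL0.le (abs_nonneg (S.w r t))]
        have hw2 : μ ^ 2 * S.w r t ^ 2 ≤ |S.F r t| ^ 2 := by
          have := pow_le_pow_left₀ (by positivity) hw 2
          rwa [mul_pow, sq_abs (S.w r t)] at this
        have hsp : s ^ (2 * n + 1) ≤ |S.F r t| ^ (2 * n + 1) := pow_le_pow_left₀ hs0.le hc.le _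
        have hfin : |S.F r t| * S.w r t ^ 2 ≤
            1 / (μ ^ 2 * s ^ (2 * n + 1)) * (S.F r t ^ (n + 1 + 1)) ^ 2 := by
          rw [one_div, inv_mul_eq_div, le_div_iff₀ (by positivity)]
          calc |S.F r t| * S.w r t ^ 2 * (μ ^ 2 * s ^ (2 * n + 1))
              = |S.F r t| * (μ ^ 2 * S.w r t ^ 2) * s ^ (2 * n + 1) := by ring
            _ ≤ |S.F r t| * |S.F r t| ^ 2 * |S.F r t| ^ (2 * n + 1) := by gcongr
            _ = (|S.F r t| ^ (n + 1 + 1)) ^ 2 := by ring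
            _ = _ := by rw [← abs_pow, sq_abs]
        have h0 : 0 ≤ s * S.w r t ^ 2 := by positivity
        linarith
    have := mul_le_mul_of_nonneg_right key hr0
    nlinarith
  refine h1.trans ?_
  rw [intervalIntegral.integral_add (ii_of hR.le (by fun_prop)) (ii_of hR.le (by fun_prop)),
    intervalIntegral.integral_const_mul, intervalIntegral.integral_const_mul]
  change s * S.W t + _ ≤ _
  gcongr
  have h2 : 1 / (μ ^ 2 * s ^ (2 * n + 1)) * ∫ r in (0:ℝ)..R, (S.F r t ^ (n + 1 + 1)) ^ 2 * r ≤
      1 / (μ ^ 2 * s ^ (2 * n + 1)) * (C * (b + f) ^ (n + 1) * f) :=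
    mul_le_mul_of_nonneg_left hg (by positivity)
  refine h2.trans ?_
  rw [one_div, inv_mul_eq_div, div_le_div_iff₀ (by positivity) (by positivity)]
  have h3 : q ^ (2 * n + 1) * Ng ^ 2 ≤ s ^ (2 * n + 1) := by
    calc q ^ (2 * n + 1) * Ng ^ 2 ≤ q ^ (2 * n + 1) * Nd ^ (2 * n + 1) := by gcongr
      _ = (Nd * q) ^ (2 * n + 1) := by rw [mul_pow]; ring
      _ ≤ s ^ (2 * n + 1) := by
        apply pow_le_pow_left₀ (by positivity)
        have : 0 < Ng := by linarith
        linarith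
  calc C * (b + f) ^ (n + 1) * f * Ng ^ 2 = C * q * f * (q ^ (2 * n + 1) * Ng ^ 2) := by
        rw [← hqsq]; ring
    _ ≤ C * q * f * s ^ (2 * n + 1) := by gcongr
    _ = _ := by field_simp

lemma dY_bound {μ β γ R : ℝ} (hμ : 0 < μ) (hβ : 1 < β) (hγ : 1 < γ) (hβγ : β ≤ γ) (hR : 0 < R) :
    ∃ C > 0, ∀ T : ℝ, ∀ S : Sol μ β γ R T, ∀ N t : ℝ, 1 ≤ N → t ∈ Icc 0 T →
      (∀ r ∈ Icc 0 R, S.ρ r t ≤ N) →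
    (∫ r in (0:ℝ)..R,
    (-(S.ρ r t * S.ud r t ^ 2 * r) +
      ((2 * μ + S.L r t - β * S.L r t) * S.w r t ^ 3 / 2 + (γ - 1) * S.P r t * S.w r t ^ 2
        - S.F r t * S.w r t ^ 2) * r - S.u r t ^ 2 * (S.ρ r t * S.ud r t))) ≤
      C * N ^ β * (1 + S.X t) * (S.X t + (N ^ γ) ^ 2) := by
  obtain ⟨K1, hK1, hFw⟩ := Fw_bound hμ hβ hγ hR
  set K2 := 2 * (2 * μ + 1) + R ^ 2 with hK2
  set K3 := 1 / (2 * μ) with hK3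
  set c1 := 1 + β + γ with hc1
  have hK2p : 0 < K2 := by positivity
  have hK3p : 0 < K3 := by positivity
  have hc1p : 0 < c1 := by positivity
  refine ⟨_, ?_, fun T S N t hN ht hρ => numeric_bound (N := N) (Nβ := N ^ β)
    (Nd := N ^ ((β - 1) / 2)) (Ng := N ^ γ) (B := S.B2 t) (X := S.X t) (W := S.W t)
    (f := ∫ r in (0:ℝ)..R, S.F r t ^ 2 * r)
    (b := ∫ r in (0:ℝ)..R, (S.ρ r t * S.ud r t) ^ 2 * r)
    (I := ∫ r in (0:ℝ)..R, |S.F r t| * S.w r t ^ 2 * r)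
    (K1 := K1) (K2 := K2) (K3 := K3) (c1 := c1)
    hN (Real.one_le_rpow hN (by linarith)) (Real.one_le_rpow hN (by linarith))
    (Real.one_le_rpow hN (by linarith)) (S.B2_nonneg ht) (S.X_nonneg ht) (S.W_nonneg t)
    (int_nonneg hR.le fun r hr => mul_nonneg (sq_nonneg _) hr.1)
    (int_nonneg hR.le fun r hr => mul_nonneg (sq_nonneg _) hr.1)
    hK1.le hK2p.le hK3p.le hc1p.le ?_ ?_ ?_ (hFw T S N t hN ht hρ) (S.f_bound hN ht hρ)
    (S.b_bound ht hρ) rfl ?_ (S.D_bound ht hρ)⟩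
  · positivity
  · have hN0 : 0 < N := by linarith
    rw [← Real.rpow_natCast, ← Real.rpow_mul hN0.le, ← Real.rpow_add_one hN0.ne']
    apply le_of_eq; congr 1; push_cast; ring
  · have hN0 : 0 < N := by linarith
    rw [← Real.rpow_natCast, ← Real.rpow_mul hN0.le]
    apply Real.rpow_le_rpow_of_exponent_le hN
    push_cast; linarith
  · conv_lhs => rw [← Real.rpow_one N]
    exact Real.rpow_le_rpow_of_exponent_le hN hβ.le
  · have := S.W_le ht
    rw [hK3, one_div, inv_mul_eq_div, le_div_iff₀ (by positivity)]
    linarith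

namespace Sol

variable {μ β γ R T : ℝ} (S : Sol μ β γ R T)

lemma Y_bounds {N t : ℝ} (ht : t ∈ Icc 0 T) (hρ : ∀ r ∈ Icc 0 R, S.ρ r t ≤ N) :
    S.X t / 4 - (N ^ γ) ^ 2 * (R ^ 2 / (4 * μ)) ≤ S.Y t ∧
    S.Y t ≤ S.X t + (N ^ γ) ^ 2 * (R ^ 2 / (4 * μ)) := by
  have c3 := slice ht S.cP
  have c7 := S.cw; have c8 := slice ht S.cL
  have hμ := S.hμ
  have key : ∀ r ∈ Icc 0 R, |S.P r t * S.w r t| ≤ μ / 2 * S.w r t ^ 2 + (N ^ γ) ^ 2 / (2 * μ) := by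
    intro r hr
    have hP := S.P_le hr ht (hρ r hr)
    have hP0 := S.P_pos hr ht
    have h1 : S.P r t ^ 2 / (2 * μ) ≤ (N ^ γ) ^ 2 / (2 * μ) := by gcongr
    refine le_trans ?_ (by linarith : μ / 2 * S.w r t ^ 2 + S.P r t ^ 2 / (2 * μ) ≤ _)
    have e : μ / 2 * S.w r t ^ 2 + S.P r t ^ 2 / (2 * μ) - |S.P r t * S.w r t|
        = (μ * |S.w r t| - S.P r t) ^ 2 / (2 * μ) := by
      rw [abs_mul, abs_of_pos hP0, ← sq_abs (S.w r t)]; field_simp; ring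
    have : 0 ≤ (μ * |S.w r t| - S.P r t) ^ 2 / (2 * μ) := by positivity
    linarith
  have hW := S.W_le ht
  have hWn := S.W_nonneg t
  have hX := S.X_nonneg ht
  have i1 : ∫ r in (0:ℝ)..R, (1 / 2 * ((2 * μ + S.L r t) * S.w r t ^ 2 * r) -
      (μ / 2 * (S.w r t ^ 2 * r) + (N ^ γ) ^ 2 / (2 * μ) * r))
      = 1 / 2 * S.X t - (μ / 2 * S.W t + (N ^ γ) ^ 2 / (2 * μ) * (R ^ 2 / 2)) := by
    rw [intervalIntegral.integral_sub (ii_of S.hR.le (by fun_prop)) (ii_of S.hR.le (by fun_prop)),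
      intervalIntegral.integral_add (ii_of S.hR.le (by fun_prop)) (ii_of S.hR.le (by fun_prop)),
      intervalIntegral.integral_const_mul, intervalIntegral.integral_const_mul,
      intervalIntegral.integral_const_mul, int_r S.hR.le]
    rfl
  have i2 : ∫ r in (0:ℝ)..R, (1 / 2 * ((2 * μ + S.L r t) * S.w r t ^ 2 * r) +
      (μ / 2 * (S.w r t ^ 2 * r) + (N ^ γ) ^ 2 / (2 * μ) * r))
      = 1 / 2 * S.X t + (μ / 2 * S.W t + (N ^ γ) ^ 2 / (2 * μ) * (R ^ 2 / 2)) := by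
    rw [intervalIntegral.integral_add (ii_of S.hR.le (by fun_prop)) (ii_of S.hR.le (by fun_prop)),
      intervalIntegral.integral_add (ii_of S.hR.le (by fun_prop)) (ii_of S.hR.le (by fun_prop)),
      intervalIntegral.integral_const_mul, intervalIntegral.integral_const_mul,
      intervalIntegral.integral_const_mul, int_r S.hR.le]
    rfl
  have e : (N ^ γ) ^ 2 / (2 * μ) * (R ^ 2 / 2) = (N ^ γ) ^ 2 * (R ^ 2 / (4 * μ)) := by
    field_simp; ring
  rw [e] at i1 i2
  constructor
  · have : 1 / 2 * S.X t - (μ / 2 * S.W t + (N ^ γ) ^ 2 * (R ^ 2 / (4 * μ))) ≤ S.Y t := by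
      rw [← i1, Y]
      refine int_mono S.hR.le (by fun_prop) (by fun_prop) fun r hr => ?_
      have h1 := mul_le_mul_of_nonneg_right ((le_abs_self _).trans (key r hr)) hr.1
      linarith
    linarith
  · have : S.Y t ≤ 1 / 2 * S.X t + (μ / 2 * S.W t + (N ^ γ) ^ 2 * (R ^ 2 / (4 * μ))) := by
      rw [← i2, Y]
      refine int_mono S.hR.le (by fun_prop) (by fun_prop) fun r hr => ?_
      have h1 := mul_le_mul_of_nonneg_right ((neg_le_abs _).trans (key r hr)) hr.1
      linarith
    linarith

lemma exists_time {M t : ℝ} (hE : S.E 0 ≤ M) (hX : S.X 0 ≤ M) (ht : t ∈ Icc 0 T) :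
    ∃ s ∈ Icc 0 t, t - s ≤ 1 ∧ S.X s ≤ M := by
  by_cases h : t ≤ 1
  · exact ⟨0, ⟨le_rfl, ht.1⟩, by linarith, hX⟩
  · push Not at h
    obtain ⟨s, hs, hse⟩ := exists_hasDerivAt_eq_slope S.E (fun s => - S.X s)
      (by linarith : t - 1 < t) (S.cE.mono (Icc_subset_Icc (by linarith) ht.2))
      (fun x hx => S.dE ⟨by linarith [hx.1], by linarith [hx.2, ht.2]⟩)
    refine ⟨s, ⟨by linarith [hs.1], hs.2.le⟩, by linarith [hs.1], ?_⟩
    have h1 := S.E_nonneg ht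
    have h2 := S.E_le (t := t - 1) ⟨by linarith, by linarith [ht.2]⟩
    have : t - (t - 1) = 1 := by ring
    rw [this, div_one] at hse
    linarith

end Sol

lemma X_exp {μ β γ R M : ℝ} (hμ : 0 < μ) (hβ : 1 < β) (hγ : 1 < γ) (hβγ : β ≤ γ) (hR : 0 < R)
    (hM : 0 ≤ M) :
    ∃ C > 0, ∀ T : ℝ, ∀ S : Sol μ β γ R T, ∀ N : ℝ, 1 ≤ N →
      (∀ r ∈ Icc 0 R, ∀ t ∈ Icc 0 T, S.ρ r t ≤ N) → S.E 0 ≤ M → S.X 0 ≤ M →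
      ∀ t ∈ Icc 0 T, S.X t ≤ Real.exp (C * N ^ β) := by
  obtain ⟨C, hC, hdY⟩ := dY_bound hμ hβ hγ hβγ hR
  set K := R ^ 2 / (4 * μ) + 1 with hK
  have hK1 : 1 ≤ K := by rw [hK]; have : 0 ≤ R ^ 2 / (4 * μ) := by positivity
                         linarith
  have hlogMK : 0 ≤ Real.log (M + 2 * K) := Real.log_nonneg (by linarith)
  have hlog4 : 0 < Real.log 4 := Real.log_pos (by norm_num)
  refine ⟨Real.log 4 + Real.log (M + 2 * K) + 2 * γ + 4 * C * (M + 1), by positivity,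
    fun T S N hN hρ hE0 hX0 t ht => ?_⟩
  have hN0 : 0 < N := by linarith
  have hNβ : 1 ≤ N ^ β := Real.one_le_rpow hN (by linarith)
  have hNg : 1 ≤ N ^ γ := Real.one_le_rpow hN (by linarith)
  have hNNβ : N ≤ N ^ β := by
    conv_lhs => rw [← Real.rpow_one N]
    exact Real.rpow_le_rpow_of_exponent_le hN hβ.le
  have hlogN : Real.log (N ^ γ) ≤ γ * N ^ β := by
    rw [Real.log_rpow hN0]
    have := Real.log_le_sub_one_of_pos hN0
    gcongr; linarith
  set Ng := N ^ γ with hNgd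
  have hZ : ∀ s ∈ Icc 0 T, S.X s / 4 + Ng ^ 2 ≤ S.Y s + K * Ng ^ 2 ∧
      S.Y s + K * Ng ^ 2 ≤ S.X s + 2 * K * Ng ^ 2 := by
    intro s hs
    obtain ⟨h1, h2⟩ := S.Y_bounds hs (fun r hr => hρ r hr s hs)
    have h3 : 0 ≤ Ng ^ 2 := by positivity
    have h4 : K * Ng ^ 2 = Ng ^ 2 * (R ^ 2 / (4 * μ)) + Ng ^ 2 := by rw [hK]; ring
    rw [← hNgd] at h1 h2
    constructor
    · linarith
    · linarith
  have hNg2 : 1 ≤ Ng ^ 2 := one_le_pow₀ hNg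
  have hZ1 : ∀ s ∈ Icc 0 T, 0 < S.Y s + K * Ng ^ 2 := fun s hs => by
    have := (hZ s hs).1
    have := S.X_nonneg hs
    linarith
  set c := 4 * C * N ^ β with hc
  have hc0 : 0 < c := by positivity
  have hanti : AntitoneOn (fun s => Real.log (S.Y s + K * Ng ^ 2) + c * S.E s - c * s) (Icc 0 T) := by
    have hder : ∀ s ∈ Ioo 0 T, HasDerivAt
        (fun s => Real.log (S.Y s + K * Ng ^ 2) + c * S.E s - c * s) _ s := fun s hs =>
      ((((S.dY hs).add_const (K * Ng ^ 2)).log (hZ1 s (Ioo_subset_Icc_self hs)).ne').add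
        ((S.dE hs).const_mul c)).sub ((hasDerivAt_id s).const_mul c)
    apply antitoneOn_of_deriv_nonpos (convex_Icc 0 T)
    · have h1 := S.cY; have h2 := S.cE
      refine ((ContinuousOn.log (by fun_prop) (fun s hs => (hZ1 s hs).ne')).add (by fun_prop)).sub
        (by fun_prop)
    · intro s hs
      rw [interior_Icc] at hs
      exact (hder s hs).differentiableAt.differentiableWithinAt
    · intro s hs
      rw [interior_Icc] at hs
      rw [(hder s hs).deriv]
      have hsc := Ioo_subset_Icc_self hs
      have h1 := hdY T S N s hN hsc (fun r hr => hρ r hr s hsc)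
      have h2 := (hZ s hsc).1
      have hXs := S.X_nonneg hsc
      have h3 : C * N ^ β * (1 + S.X s) * (S.X s + (N ^ γ) ^ 2) ≤
          c * (1 + S.X s) * (S.Y s + K * Ng ^ 2) := by
        have : S.X s + (N ^ γ) ^ 2 ≤ 4 * (S.Y s + K * Ng ^ 2) := by rw [← hNgd]; linarith
        have := mul_le_mul_of_nonneg_left this (by positivity : 0 ≤ C * N ^ β * (1 + S.X s))
        rw [hc]; linarith
      have h4 := (div_le_iff₀ (hZ1 s hsc)).2 (h1.trans h3)
      linarith
  obtain ⟨s, hs, hst, hXs⟩ := S.exists_time hE0 hX0 ht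
  have hsT : s ∈ Icc 0 T := ⟨hs.1, hs.2.trans ht.2⟩
  have h1 := hanti hsT ht hs.2
  simp only at h1
  have hEs := S.E_le hsT
  have hEt := S.E_nonneg ht
  have hlogs : Real.log (S.Y s + K * Ng ^ 2) ≤ Real.log (M + 2 * K) + 2 * (γ * N ^ β) := by
    have h2 : S.Y s + K * Ng ^ 2 ≤ (M + 2 * K) * Ng ^ 2 := by
      have := (hZ s hsT).2
      have h5 := le_mul_of_one_le_right hM hNg2
      linarith
    refine (Real.log_le_log (hZ1 s hsT) h2).trans ?_
    rw [Real.log_mul (by positivity) (by positivity), Real.log_pow]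
    push_cast
    linarith
  have hcE : c * (S.E s - S.E t) ≤ c * M := mul_le_mul_of_nonneg_left (by linarith) hc0.le
  have hct : c * (t - s) ≤ c * 1 := mul_le_mul_of_nonneg_left hst hc0.le
  have hlogt : Real.log (S.Y t + K * Ng ^ 2) ≤
      Real.log (M + 2 * K) + 2 * (γ * N ^ β) + c * (M + 1) := by linarith
  have hXt : S.X t ≤ 4 * (S.Y t + K * Ng ^ 2) := by
    have := (hZ t ht).1
    linarith
  refine hXt.trans ?_
  rw [← Real.log_le_iff_le_exp (mul_pos (by norm_num) (hZ1 t ht)),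
    Real.log_mul (by norm_num) (hZ1 t ht).ne']
  have k1 := le_mul_of_one_le_right (by linarith : 0 ≤ Real.log 4 + Real.log (M + 2 * K)) hNβ
  rw [hc] at hlogt
  linarith

lemma mom_bound {μ β γ R M : ℝ} (hμ : 0 < μ) (hβ : 1 < β) (hγ : 1 < γ) (hβγ : β ≤ γ) (hR : 0 < R)
    (hM : 0 ≤ M) :
    ∃ C > 0, ∀ T : ℝ, ∀ S : Sol μ β γ R T, ∀ N : ℝ, 1 ≤ N →
      (∀ r ∈ Icc 0 R, ∀ t ∈ Icc 0 T, S.ρ r t ≤ N) → S.E 0 ≤ M → S.X 0 ≤ M →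
      ∀ t ∈ Icc 0 T, ∫ r in (0:ℝ)..R, S.ρ r t * |S.u r t| ≤ C * N ^ ((β + 1) / 2) := by
  obtain ⟨C, hC, hX⟩ := X_exp hμ hβ hγ hβγ hR hM
  refine ⟨R * ((1 + 1 / (2 * μ)) / 2) + (M + C / 2), by positivity,
    fun T S N hN hρ hE0 hX0 t ht => ?_⟩
  have hXt := hX T S N hN hρ hE0 hX0 t ht
  have c1 := S.cρ; have c2 := S.cu; have c3 := slice ht S.cP
  have hN0 : 0 < N := by linarith
  have hκ0 : 0 ≤ C * N ^ β := by positivity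
  set κ := C * N ^ β with hκ
  set δ := R * Real.exp (-κ) with hδ
  have hδ0 : 0 < δ := by positivity
  have hδR : δ ≤ R := by
    have : Real.exp (-κ) ≤ 1 := Real.exp_le_one_iff.2 (by linarith)
    exact mul_le_of_le_one_right hR.le this
  set a := N ^ ((β + 1) / 2) with ha
  have ha0 : 0 < a := by positivity
  have haN : N ≤ a := by
    conv_lhs => rw [← Real.rpow_one N]
    exact Real.rpow_le_rpow_of_exponent_le hN (by linarith)
  have ha2 : N * κ = C * a * a := by
    rw [hκ, ha, mul_assoc C, ← Real.rpow_add hN0]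
    have : (β + 1) / 2 + (β + 1) / 2 = β + 1 := by ring
    rw [this, Real.rpow_add_one hN0.ne']; ring
  have hsplit : ∫ r in (0:ℝ)..R, S.ρ r t * |S.u r t| =
      (∫ r in (0:ℝ)..δ, S.ρ r t * |S.u r t|) + ∫ r in δ..R, S.ρ r t * |S.u r t| :=
    (intervalIntegral.integral_add_adjacent_intervals
      (Continuous.intervalIntegrable (by fun_prop) _ _)
      (Continuous.intervalIntegrable (by fun_prop) _ _)).symm
  rw [hsplit]
  have hin : ∫ r in (0:ℝ)..δ, S.ρ r t * |S.u r t| ≤ R * ((1 + 1 / (2 * μ)) / 2) * a := by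
    have hpt : ∀ r ∈ Icc 0 δ, S.ρ r t * |S.u r t| ≤ N * ((1 + Real.exp κ / (2 * μ)) / 2) := by
      intro r hr
      have hr' : r ∈ Icc 0 R := ⟨hr.1, hr.2.trans hδR⟩
      have h1 := S.u_sq_le hr' ht
      have h2 := S.W_le ht
      have h3 : S.W t ≤ Real.exp κ / (2 * μ) := by
        rw [le_div_iff₀ (by positivity)]; linarith
      refine mul_le_mul (hρ r hr' t ht) ?_ (abs_nonneg _) hN0.le
      have h4 := sq_nonneg (|S.u r t| - 1)
      have h5 := sq_abs (S.u r t)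
      nlinarith
    have h1 : ∫ r in (0:ℝ)..δ, S.ρ r t * |S.u r t| ≤
        ∫ r in (0:ℝ)..δ, N * ((1 + Real.exp κ / (2 * μ)) / 2) :=
      int_mono hδ0.le (by fun_prop) (by fun_prop) hpt
    refine h1.trans ?_
    rw [intervalIntegral.integral_const, smul_eq_mul, sub_zero]
    have e1 : Real.exp (-κ) * Real.exp κ = 1 := by rw [← Real.exp_add]; simp
    have e2 : Real.exp (-κ) ≤ 1 := Real.exp_le_one_iff.2 (by linarith)
    have e3 : δ * (N * ((1 + Real.exp κ / (2 * μ)) / 2)) =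
        R * N * ((Real.exp (-κ) + (Real.exp (-κ) * Real.exp κ) / (2 * μ)) / 2) := by rw [hδ]; ring
    rw [e3, e1]
    calc R * N * ((Real.exp (-κ) + 1 / (2 * μ)) / 2) ≤ R * a * ((1 + 1 / (2 * μ)) / 2) := by gcongr
      _ = _ := by ring
  have hout : ∫ r in δ..R, S.ρ r t * |S.u r t| ≤ (M + C / 2) * a := by
    have cg : ContinuousOn (fun r => a * ((S.ρ r t * S.u r t ^ 2 / 2 + S.P r t / (γ - 1)) * r))
        (Icc 0 R) := by fun_prop
    have ci : ContinuousOn (fun r : ℝ => N / (2 * a) * r⁻¹) (Icc δ R) := by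
      refine continuousOn_const.mul (ContinuousOn.inv₀ continuousOn_id ?_)
      intro r hr; have : 0 < r := by linarith [hr.1]
      exact this.ne'
    have hsub : Icc δ R ⊆ Icc 0 R := Icc_subset_Icc hδ0.le le_rfl
    have i1 := (cg.mono hsub).intervalIntegrable_of_Icc (μ := volume) hδR
    have i2 := ci.intervalIntegrable_of_Icc (μ := volume) hδR
    have h1 : ∫ r in δ..R, S.ρ r t * |S.u r t| ≤
        ∫ r in δ..R, (a * ((S.ρ r t * S.u r t ^ 2 / 2 + S.P r t / (γ - 1)) * r)
          + N / (2 * a) * r⁻¹) := by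
      refine intervalIntegral.integral_mono_on hδR (Continuous.intervalIntegrable (by fun_prop) _ _)
        (i1.add i2) fun r hr => ?_
      have hr' := hsub hr
      have hr0 : 0 < r := by linarith [hr.1]
      have hρ0 := S.pos r hr' t ht
      have hP0 := S.P_pos hr' ht
      have hγ1 : 0 < γ - 1 := by linarith
      have k1 : S.ρ r t * |S.u r t| ≤ a * (S.ρ r t * S.u r t ^ 2 / 2 * r)
          + S.ρ r t / (2 * a) * r⁻¹ := by
        have : a * (S.ρ r t * S.u r t ^ 2 / 2 * r) + S.ρ r t / (2 * a) * r⁻¹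
          - S.ρ r t * |S.u r t| = S.ρ r t * (a * r * |S.u r t| - 1) ^ 2 / (2 * a * r) := by
          rw [← sq_abs (S.u r t)]; field_simp; ring
        have : 0 ≤ S.ρ r t * (a * r * |S.u r t| - 1) ^ 2 / (2 * a * r) := by positivity
        linarith
      have k2 : S.ρ r t / (2 * a) * r⁻¹ ≤ N / (2 * a) * r⁻¹ := by
        have := hρ r hr' t ht
        gcongr
      have k3 : 0 ≤ a * (S.P r t / (γ - 1) * r) := by positivity
      linarith
    refine h1.trans ?_
    rw [intervalIntegral.integral_add i1 i2, intervalIntegral.integral_const_mul,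
      intervalIntegral.integral_const_mul, integral_inv_of_pos hδ0 hR]
    have hlog : Real.log (R / δ) = κ := by
      rw [hδ, div_mul_cancel_left₀ hR.ne', Real.exp_neg, inv_inv, Real.log_exp]
    rw [hlog]
    have cE : ContinuousOn (fun r => ((S.ρ r t * S.u r t ^ 2 / 2 + S.P r t / (γ - 1)) * r))
        (Icc 0 R) := by fun_prop
    have hEb : ∫ r in δ..R, ((S.ρ r t * S.u r t ^ 2 / 2 + S.P r t / (γ - 1)) * r) ≤ S.E t := by
      refine int_le_of_bound hR.le ⟨hδ0.le, hδR⟩ ⟨hδR, le_rfl⟩ cE cE (fun _ _ => le_rfl) ?_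
      intro r hr
      have hρ0 := S.pos r hr t ht
      have hP0 := S.P_pos hr ht
      have hγ1 : 0 < γ - 1 := by linarith
      have := hr.1
      positivity
    have hE := S.E_le ht
    have e1 : N / (2 * a) * κ = C / 2 * a := by
      rw [div_mul_eq_mul_div, ha2]; field_simp
    rw [e1]
    have := mul_le_mul_of_nonneg_left (hEb.trans (hE.trans hE0)) ha0.le
    linarith
  linarith

lemma deriv_nonneg_of_left_max {f : ℝ → ℝ} {d t : ℝ} (ht : 0 < t) (hd : HasDerivAt f d t)
    (h : ∀ τ ∈ Icc 0 t, f τ ≤ f t) : 0 ≤ d := by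
  have h1 : Tendsto (slope f t) (nhdsWithin t (Iio t)) (nhds d) :=
    (hasDerivAt_iff_tendsto_slope.1 hd).mono_left
      (nhdsWithin_mono t (fun x hx => (ne_of_lt hx : x ≠ t)))
  refine ge_of_tendsto h1 ?_
  have : Ioo 0 t ∈ nhdsWithin t (Iio t) := Ioo_mem_nhdsLT ht
  filter_upwards [this] with τ hτ
  rw [slope_def_field]
  apply div_nonneg_of_nonpos
  · linarith [h τ ⟨hτ.1.le, hτ.2.le⟩]
  · linarith [hτ.2]

namespace Sol

variable {μ β γ R T : ℝ} (S : Sol μ β γ R T)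

/-- time derivative of the momentum -/
def q (r t : ℝ) : ℝ := (-(S.u r t * S.ρr r t) - S.ρ r t * S.w r t) * S.u r t + S.ρ r t * S.ut r t

def ψ (r t : ℝ) : ℝ := ∫ s in r..R, S.ρ s t * S.u s t

def m (t : ℝ) : ℝ := (∫ s in (0:ℝ)..R, S.ρ s t * S.u s t * s ^ 2) / R ^ 2

def θ (r t : ℝ) : ℝ := 2 * μ * Real.log (S.ρ r t) + S.L r t / β

lemma cq : Continuous (fun p : ℝ × ℝ => S.q p.1 p.2) := by
  have c1 := S.cρ; have c2 := S.cu; have c3 := S.cρr; have c4 := S.cw; have c5 := S.cut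
  unfold q; fun_prop

lemma dρu {r t : ℝ} (hr : r ∈ Icc 0 R) (ht : t ∈ Icc 0 T) :
    HasDerivAt (fun τ => S.ρ r τ * S.u r τ) (S.q r t) t :=
  (S.dρt r hr t ht).mul (S.dut r hr t ht)

lemma cψ : Continuous (fun p : ℝ × ℝ => S.ψ p.1 p.2) := by
  have c1 := S.cρ; have c2 := S.cu
  have h : Continuous (fun p : ℝ × ℝ => ∫ s in R..p.1, S.ρ s p.2 * S.u s p.2) :=
    intervalIntegral.continuous_parametric_intervalIntegral_of_continuous
      (f := fun (p : ℝ × ℝ) s => S.ρ s p.2 * S.u s p.2) (by fun_prop) continuous_fst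
  have : (fun p : ℝ × ℝ => S.ψ p.1 p.2) = fun p => -∫ s in R..p.1, S.ρ s p.2 * S.u s p.2 := by
    funext p
    rw [ψ, intervalIntegral.integral_symm]
  rw [this]
  exact h.neg

lemma cm : Continuous S.m := by
  have c1 := S.cρ; have c2 := S.cu
  have h : Continuous (fun t : ℝ => ∫ s in (0:ℝ)..R, S.ρ s t * S.u s t * s ^ 2) :=
    intervalIntegral.continuous_parametric_intervalIntegral_of_continuous
      (f := fun (t : ℝ) s => S.ρ s t * S.u s t * s ^ 2) (by fun_prop) continuous_const
  exact h.div_const _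

lemma dψr (r t : ℝ) : HasDerivAt (fun s => S.ψ s t) (-(S.ρ r t * S.u r t)) r := by
  have c1 := S.cρ; have c2 := S.cu
  have hc : Continuous (fun s => S.ρ s t * S.u s t) := by fun_prop
  exact intervalIntegral.integral_hasDerivAt_left (hc.intervalIntegrable _ _)
    (hc.stronglyMeasurableAtFilter _ _) hc.continuousAt

lemma dψt {r t : ℝ} (hr : r ∈ Icc 0 R) (ht : t ∈ Ioo 0 T) :
    HasDerivAt (fun τ => S.ψ r τ) (S.F R t - S.F r t + S.ρ r t * S.u r t ^ 2
      - ∫ s in r..R, S.ρ s t * S.u s t * S.v s t) t := by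
  have c1 := S.cρ; have c2 := S.cu; have c3 := S.cρr; have c4 := S.cw; have c5 := S.cut
  have c6 := S.cq; have c7 := S.cud; have c8 := S.cv; have c9 := S.cur
  have htc := Ioo_subset_Icc_self ht
  have hsub : Icc r R ⊆ Icc 0 R := Icc_subset_Icc hr.1 le_rfl
  have hd := hasDerivAt_param (a := r) (R := R) (T := T) hr.2
    (f := fun s t => S.ρ s t * S.u s t) (f' := S.q) (fun τ _ => by fun_prop) (by fun_prop)
    (fun s hs τ hτ => S.dρu (hsub hs) hτ) ht
  refine hd.congr_deriv ?_
  have c10 := (slice htc S.cF).mono hsub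
  have hflux := intervalIntegral.integral_eq_sub_of_hasDerivAt_of_le hr.2
    (f := fun s => S.F s t - S.ρ s t * S.u s t ^ 2)
    (f' := fun s => S.ρ s t * S.ud s t - (S.ρr s t * S.u s t ^ 2
      + S.ρ s t * (2 * S.u s t * S.ur s t))) (by fun_prop)
    (fun s hs => by
      have hs' := hsub (Ioo_subset_Icc_self hs)
      refine ((S.dF hs' htc).sub ((S.dρr s hs' t htc).mul
        ((S.dur s hs' t htc).pow 2))).congr_deriv (by simp))
    (Continuous.intervalIntegrable (by fun_prop) _ _)
  have e : ∫ s in r..R, S.q s t = (∫ s in r..R, (S.ρ s t * S.ud s t - (S.ρr s t * S.u s t ^ 2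
      + S.ρ s t * (2 * S.u s t * S.ur s t)))) - ∫ s in r..R, S.ρ s t * S.u s t * S.v s t := by
    rw [← intervalIntegral.integral_sub (Continuous.intervalIntegrable (by fun_prop) _ _)
      (Continuous.intervalIntegrable (by fun_prop) _ _)]
    refine intervalIntegral.integral_congr fun s hs => ?_
    rw [uIcc_of_le hr.2] at hs
    simp only [q, ud, S.hw s (hsub hs) t htc]
    ring
  rw [e, hflux, S.bcR t htc]
  ring

lemma int_w {t : ℝ} (ht : t ∈ Icc 0 T) : ∫ s in (0:ℝ)..R, S.w s t * s = 0 := by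
  have c2 := S.cu; have c4 := S.cw; have c9 := S.cur
  have hflux := intervalIntegral.integral_eq_sub_of_hasDerivAt_of_le S.hR.le
    (f := fun s => s * S.u s t) (f' := fun s => S.u s t + s * S.ur s t) (by fun_prop)
    (fun s hs => by
      refine ((hasDerivAt_id s).mul (S.dur s (Ioo_subset_Icc_self hs) t ht)).congr_deriv (by simp))
    (Continuous.intervalIntegrable (by fun_prop) _ _)
  rw [S.bcR t ht] at hflux
  refine Eq.trans ?_ (hflux.trans (by ring))
  refine intervalIntegral.integral_congr fun s hs => ?_
  rw [uIcc_of_le S.hR.le] at hs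
  simp only [S.hw s hs t ht]
  rw [S.hv s hs t ht]; ring

lemma dm {t : ℝ} (ht : t ∈ Ioo 0 T) :
    HasDerivAt S.m (S.F R t + (∫ s in (0:ℝ)..R, (S.ρ s t * S.u s t ^ 2 + 2 * S.P s t
      - 2 * (S.L s t * S.w s t)) * s) / R ^ 2) t := by
  have c1 := S.cρ; have c2 := S.cu; have c3 := S.cρr; have c4 := S.cw; have c5 := S.cut
  have c6 := S.cq; have c7 := S.cud; have c8 := S.cv; have c9 := S.cur
  have htc := Ioo_subset_Icc_self ht
  have c10 := slice htc S.cF; have c11 := slice htc S.cP; have c12 := slice htc S.cL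
  have hd := (hasDerivAt_param (a := 0) (R := R) (T := T) S.hR.le
    (f := fun s t => S.ρ s t * S.u s t * s ^ 2) (f' := fun s t => S.q s t * s ^ 2)
    (fun τ _ => by fun_prop) (by fun_prop)
    (fun s hs τ hτ => (S.dρu hs hτ).mul_const _) ht).div_const (R ^ 2)
  refine hd.congr_deriv ?_
  have hflux := intervalIntegral.integral_eq_sub_of_hasDerivAt_of_le S.hR.le
    (f := fun s => (S.F s t - S.ρ s t * S.u s t ^ 2) * s ^ 2)
    (f' := fun s => (S.ρ s t * S.ud s t - (S.ρr s t * S.u s t ^ 2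
      + S.ρ s t * (2 * S.u s t * S.ur s t))) * s ^ 2
      + (S.F s t - S.ρ s t * S.u s t ^ 2) * (2 * s)) (by fun_prop)
    (fun s hs => by
      have hs' := (Ioo_subset_Icc_self hs)
      refine (((S.dF hs' htc).sub ((S.dρr s hs' t htc).mul
        ((S.dur s hs' t htc).pow 2))).mul ((hasDerivAt_id s).pow 2)).congr_deriv (by simp))
    (ii_of S.hR.le (by fun_prop))
  have e : ∫ s in (0:ℝ)..R, S.q s t * s ^ 2 = (∫ s in (0:ℝ)..R,
      ((S.ρ s t * S.ud s t - (S.ρr s t * S.u s t ^ 2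
      + S.ρ s t * (2 * S.u s t * S.ur s t))) * s ^ 2
      + (S.F s t - S.ρ s t * S.u s t ^ 2) * (2 * s))) + (∫ s in (0:ℝ)..R,
      (S.ρ s t * S.u s t ^ 2 + 2 * S.P s t - 2 * (S.L s t * S.w s t)) * s)
      - 4 * μ * ∫ s in (0:ℝ)..R, S.w s t * s := by
    rw [← intervalIntegral.integral_const_mul,
      ← intervalIntegral.integral_add (ii_of S.hR.le (by fun_prop)) (ii_of S.hR.le (by fun_prop)),
      ← intervalIntegral.integral_sub (ii_of S.hR.le (by fun_prop)) (ii_of S.hR.le (by fun_prop))]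
    refine intervalIntegral.integral_congr fun s hs => ?_
    rw [uIcc_of_le S.hR.le] at hs
    simp only [q, ud, F]
    rw [S.hv s hs t htc]
    have e2 : S.ur s t = S.w s t - S.v s t := by rw [S.hw s hs t htc]; ring
    simp only [e2]
    ring
  have hR := S.hR.ne'
  rw [e, hflux, S.bcR t htc, S.int_w htc]
  field_simp
  ring

lemma dθr {r t : ℝ} (hr : r ∈ Icc 0 R) (ht : t ∈ Icc 0 T) :
    HasDerivAt (fun s => S.θ s t) (2 * μ * (S.ρr r t / S.ρ r t) + S.Lr r t / β) r :=
  (((S.dρr r hr t ht).log (S.pos r hr t ht).ne').const_mul (2 * μ)).add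
    ((S.dLr r hr t ht).div_const β)

lemma dθt {r t : ℝ} (hr : r ∈ Icc 0 R) (ht : t ∈ Icc 0 T) :
    HasDerivAt (fun τ => S.θ r τ) (2 * μ * ((-(S.u r t * S.ρr r t) - S.ρ r t * S.w r t) / S.ρ r t)
      + (-(S.u r t * S.Lr r t) - β * S.L r t * S.w r t) / β) t :=
  (((S.dρt r hr t ht).log (S.pos r hr t ht).ne').const_mul (2 * μ)).add
    ((S.dLt r hr t ht).div_const β)

lemma cθ : ContinuousOn (fun p : ℝ × ℝ => S.θ p.1 p.2) (Icc 0 R ×ˢ Icc 0 T) := by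
  have c1 := S.cρ; have c2 := S.cL
  refine ContinuousOn.add (continuousOn_const.mul (ContinuousOn.log (by fun_prop) ?_)) (by fun_prop)
  rintro ⟨r, t⟩ ⟨hr, ht⟩
  exact (S.pos r hr t ht).ne'

lemma ψ_abs {r t : ℝ} (hr : r ∈ Icc 0 R) (ht : t ∈ Icc 0 T) :
    |S.ψ r t| ≤ ∫ s in (0:ℝ)..R, S.ρ s t * |S.u s t| := by
  have c1 := S.cρ; have c2 := S.cu
  have habs : |S.ψ r t| ≤ ∫ s in r..R, |S.ρ s t * S.u s t| :=
    intervalIntegral.abs_integral_le_integral_abs hr.2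
  refine habs.trans (int_le_of_bound S.hR.le hr ⟨hr.2, le_rfl⟩ (by fun_prop) (by fun_prop) ?_ ?_)
  · intro s hs
    rw [abs_mul, abs_of_pos (S.pos s hs t ht)]
  · intro s hs
    have := S.pos s hs t ht
    positivity

lemma m_abs {t : ℝ} (ht : t ∈ Icc 0 T) :
    |S.m t| ≤ ∫ s in (0:ℝ)..R, S.ρ s t * |S.u s t| := by
  have c1 := S.cρ; have c2 := S.cu
  have hR := S.hR
  rw [m, abs_div, abs_of_pos (by positivity : 0 < R ^ 2), div_le_iff₀ (by positivity),
    ← intervalIntegral.integral_mul_const]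
  refine (intervalIntegral.abs_integral_le_integral_abs hR.le).trans ?_
  refine int_mono hR.le (by fun_prop) (by fun_prop) fun s hs => ?_
  have h := S.pos s hs t ht
  rw [abs_mul, abs_mul, abs_of_pos h, abs_of_nonneg (sq_nonneg s)]
  exact mul_le_mul_of_nonneg_left (pow_le_pow_left₀ hs.1 hs.2 2) (by positivity)

/-- key differential inequality at a point where `u Φ_r = 0`. -/
lemma rhs_bound {N M r t : ℝ} (hβγ : β ≤ γ) (hr : r ∈ Icc 0 R) (ht : t ∈ Icc 0 T)
    (hρ : ∀ r ∈ Icc 0 R, S.ρ r t ≤ N) (hE : S.E t ≤ M) :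
    (∫ s in r..R, S.ρ s t * S.u s t * S.v s t) + (∫ s in (0:ℝ)..R, (S.ρ s t * S.u s t ^ 2
      + 2 * S.P s t - 2 * (S.L s t * S.w s t)) * s) / R ^ 2
      - (N / (2 * μ) + 1 / R ^ 2) * S.X t ≤ 3 * γ * M / R ^ 2 + 1 / 2 := by
  have c1 := S.cρ; have c2 := S.cu; have c4 := S.cw; have c8 := S.cv
  have c11 := slice ht S.cP; have c12 := slice ht S.cL
  have hμ := S.hμ; have hR := S.hR; have hγ := S.hγ
  have hγ1 : 0 < γ - 1 := by linarith
  have hN0 : 0 < N := (S.pos 0 ⟨le_rfl, S.hR.le⟩ t ht).trans_le (hρ 0 ⟨le_rfl, S.hR.le⟩)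
  have h1 : ∫ s in r..R, S.ρ s t * S.u s t * S.v s t ≤ N / (2 * μ) * S.X t := by
    have a1 : ∫ s in r..R, S.ρ s t * S.u s t * S.v s t ≤
        ∫ s in (0:ℝ)..R, N * (S.v s t ^ 2 * s) := by
      refine int_le_of_bound hR.le hr ⟨hr.2, le_rfl⟩ (by fun_prop) (by fun_prop) ?_ ?_
      · intro s hs
        rw [S.hv s hs t ht]
        have := mul_le_mul_of_nonneg_right (hρ s hs)
          (mul_nonneg (sq_nonneg (S.v s t)) hs.1)
        linarith
      · intro s hs
        have := hs.1
        positivity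
    rw [intervalIntegral.integral_const_mul] at a1
    have a2 := S.v_le ht
    have a3 := S.W_le ht
    calc _ ≤ _ := a1
      _ ≤ N * (S.X t / (2 * μ)) := by
        refine mul_le_mul_of_nonneg_left (a2.trans ?_) hN0.le
        rw [le_div_iff₀ (by positivity)]; linarith
      _ = _ := by ring
  have h2 : (∫ s in (0:ℝ)..R, (S.ρ s t * S.u s t ^ 2
      + 2 * S.P s t - 2 * (S.L s t * S.w s t)) * s) ≤ 3 * γ * S.E t + R ^ 2 / 2 + S.X t := by
    have : 3 * γ * S.E t + R ^ 2 / 2 + S.X t = ∫ s in (0:ℝ)..R,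
        ((3 * γ * ((S.ρ s t * S.u s t ^ 2 / 2 + S.P s t / (γ - 1)) * s) + s)
        + (2 * μ + S.L s t) * S.w s t ^ 2 * s) := by
      rw [intervalIntegral.integral_add (ii_of S.hR.le (by fun_prop)) (ii_of S.hR.le (by fun_prop)),
        intervalIntegral.integral_add (ii_of S.hR.le (by fun_prop)) (ii_of S.hR.le (by fun_prop)),
        intervalIntegral.integral_const_mul, int_r hR.le]
      rfl
    rw [this]
    refine int_mono hR.le (by fun_prop) (by fun_prop) fun s hs => ?_
    have hL0 := S.L_pos hs ht
    have hP0 := S.P_pos hs ht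
    have hρ0 := S.pos s hs t ht
    have hLP : S.L s t ≤ 1 + S.P s t := by
      rw [S.hL, S.hP]
      rcases le_total (S.ρ s t) 1 with h | h
      · have := Real.rpow_le_one hρ0.le h (by linarith [S.hβ] : 0 ≤ β)
        have := Real.rpow_nonneg hρ0.le γ
        linarith
      · have := Real.rpow_le_rpow_of_exponent_le h hβγ
        linarith
    have b1 : -(2 * (S.L s t * S.w s t)) ≤ S.L s t + S.L s t * S.w s t ^ 2 := by
      have := mul_nonneg hL0.le (sq_nonneg (S.w s t + 1))
      linarith
    have b2 : S.P s t ≤ γ * (S.P s t / (γ - 1)) := by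
      rw [← mul_div_assoc, le_div_iff₀ hγ1]; nlinarith
    have b3 : 0 ≤ S.ρ s t * S.u s t ^ 2 := by positivity
    have b4 : S.ρ s t * S.u s t ^ 2 ≤ γ * (S.ρ s t * S.u s t ^ 2) :=
      le_mul_of_one_le_left b3 hγ.le
    have b5 : 0 ≤ 2 * μ * S.w s t ^ 2 := by positivity
    have b6 : S.ρ s t * S.u s t ^ 2 + 2 * S.P s t - 2 * (S.L s t * S.w s t) ≤
      3 * γ * (S.ρ s t * S.u s t ^ 2 / 2 + S.P s t / (γ - 1)) + 1
        + (2 * μ + S.L s t) * S.w s t ^ 2 := by linarith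
    have := mul_le_mul_of_nonneg_right b6 hs.1
    linarith
  have h3 : (∫ s in (0:ℝ)..R, (S.ρ s t * S.u s t ^ 2
      + 2 * S.P s t - 2 * (S.L s t * S.w s t)) * s) / R ^ 2
      ≤ (3 * γ * M + R ^ 2 / 2 + S.X t) / R ^ 2 := by
    have : 3 * γ * S.E t ≤ 3 * γ * M := by gcongr
    gcongr
    linarith
  have h4 : (3 * γ * M + R ^ 2 / 2 + S.X t) / R ^ 2 = 3 * γ * M / R ^ 2 + 1 / 2
      + 1 / R ^ 2 * S.X t := by field_simp
  linarith

/-- maximum principle -/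
lemma θ_bound {N M A B r t : ℝ} (hβγ : β ≤ γ) (hr : r ∈ Icc 0 R) (ht : t ∈ Ico 0 T)
    (hρ : ∀ r ∈ Icc 0 R, ∀ t ∈ Icc 0 T, S.ρ r t ≤ N) (hE : S.E 0 ≤ M)
    (hA : ∀ t ∈ Icc 0 T, ∫ s in (0:ℝ)..R, S.ρ s t * |S.u s t| ≤ A)
    (hB1 : 1 ≤ B) (hB : 3 * γ * M / R ^ 2 + 1 / 2 ≤ B) (hB0 : ∀ r ∈ Icc 0 R, S.ρ r 0 ≤ B) :
    S.θ r t ≤ 2 * μ * Real.log B + B ^ β / β + 4 * A + (N / (2 * μ) + 1 / R ^ 2) * M := by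
  have hμ := S.hμ; have hR := S.hR; have hγ := S.hγ; have hβ := S.hβ; have hT := S.hT
  have h00 : (0:ℝ) ∈ Icc 0 R := ⟨le_rfl, hR.le⟩
  have h0T : (0:ℝ) ∈ Icc 0 T := ⟨le_rfl, hT.le⟩
  have hN0 : 0 < N := (S.pos 0 h00 0 h0T).trans_le (hρ 0 h00 0 h0T)
  set c := N / (2 * μ) + 1 / R ^ 2 with hc
  have hc0 : 0 < c := by positivity
  set Φ : ℝ → ℝ → ℝ := fun r t => S.θ r t - S.ψ r t + S.m t + c * S.E t with hΦ
  have hcΦ : ContinuousOn (fun p : ℝ × ℝ => Φ p.1 p.2) (Icc 0 R ×ˢ Icc 0 T) := by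
    have c1 := S.cθ; have c2 := S.cψ; have c3 := S.cm
    have c4 : ContinuousOn (fun p : ℝ × ℝ => S.E p.2) (Icc 0 R ×ˢ Icc 0 T) :=
      S.cE.comp continuousOn_snd (fun p hp => hp.2)
    simp only [hΦ]
    fun_prop
  have hsub : Icc 0 R ×ˢ Icc 0 t ⊆ Icc 0 R ×ˢ Icc 0 T :=
    prod_mono le_rfl (Icc_subset_Icc le_rfl ht.2.le)
  obtain ⟨⟨rs, ts⟩, ⟨hrs, hts⟩, hmax⟩ := (isCompact_Icc.prod isCompact_Icc).exists_isMaxOn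
    (⟨(r, t), hr, ht.1, le_rfl⟩ : (Icc (0:ℝ) R ×ˢ Icc 0 t).Nonempty) (hcΦ.mono hsub)
  simp only at hrs hts
  have hmax' : ∀ x ∈ Icc 0 R, ∀ y ∈ Icc 0 t, Φ x y ≤ Φ rs ts := fun x hx y hy =>
    hmax (a := (x, y)) ⟨hx, hy⟩
  have htsT : ts ∈ Icc 0 T := ⟨hts.1, hts.2.trans ht.2.le⟩
  have hρs := S.pos rs hrs ts htsT
  have hkey : S.ρ rs ts ≤ B := by
    rcases eq_or_lt_of_le hts.1 with h0 | h0
    · rw [← h0]; exact hB0 rs hrs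
    have htsI : ts ∈ Ioo 0 T := ⟨h0, hts.2.trans_lt ht.2⟩
    have hdt := (((S.dθt hrs htsT).sub (S.dψt hrs htsI)).add (S.dm htsI)).add
      ((S.dE htsI).const_mul c)
    have hdr := (((S.dθr hrs htsT).sub (S.dψr rs ts)).add_const (S.m ts)).add_const (c * S.E ts)
    have k1 := deriv_nonneg_of_left_max h0 hdt
      (fun τ hτ => hmax' rs hrs τ ⟨hτ.1, hτ.2.trans hts.2⟩)
    have k2 : S.u rs ts * (2 * μ * (S.ρr rs ts / S.ρ rs ts) + S.Lr rs ts / β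
        - -(S.ρ rs ts * S.u rs ts)) = 0 := by
      by_cases hin : rs ∈ Ioo 0 R
      · have : IsLocalMax (fun s => Φ s ts) rs := by
          filter_upwards [Icc_mem_nhds hin.1 hin.2] with s hs
          exact hmax' s hs ts hts
        rw [this.hasDerivAt_eq_zero hdr, mul_zero]
      · have : rs = 0 ∨ rs = R := by
          by_contra hcon
          push Not at hcon
          exact hin ⟨lt_of_le_of_ne hrs.1 (Ne.symm hcon.1), lt_of_le_of_ne hrs.2 hcon.2⟩
        rcases this with h | h
        · rw [h, S.bc0 htsT, zero_mul]
        · rw [h, S.bcR ts htsT, zero_mul]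
    have k3 := S.rhs_bound hβγ hrs htsT (fun r hr => hρ r hr ts htsT) ((S.E_le htsT).trans hE)
    have k4 : 2 * μ * ((-(S.u rs ts * S.ρr rs ts) - S.ρ rs ts * S.w rs ts) / S.ρ rs ts)
        + (-(S.u rs ts * S.Lr rs ts) - β * S.L rs ts * S.w rs ts) / β =
        -(S.u rs ts * (2 * μ * (S.ρr rs ts / S.ρ rs ts) + S.Lr rs ts / β
        - -(S.ρ rs ts * S.u rs ts))) + S.ρ rs ts * S.u rs ts ^ 2
        - (S.F rs ts + S.P rs ts) := by
      unfold F
      have : β ≠ 0 := by linarith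
      field_simp
      ring
    rw [k2] at k4
    rw [k4] at k1
    have k5 : S.P rs ts ≤ B := by linarith
    by_contra hcon
    push Not at hcon
    rw [S.hP] at k5
    have : S.ρ rs ts ≤ S.ρ rs ts ^ γ := by
      conv_lhs => rw [← Real.rpow_one (S.ρ rs ts)]
      exact Real.rpow_le_rpow_of_exponent_le (by linarith) hγ.le
    linarith
  have hθs : S.θ rs ts ≤ 2 * μ * Real.log B + B ^ β / β := by
    unfold θ
    rw [S.hL]
    have := Real.log_le_log hρs hkey
    have := Real.rpow_le_rpow hρs.le hkey (by linarith : 0 ≤ β)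
    gcongr
  have htT := Ico_subset_Icc_self ht
  have p1 := abs_le.1 ((S.ψ_abs hr htT).trans (hA t htT))
  have p2 := abs_le.1 ((S.ψ_abs hrs htsT).trans (hA ts htsT))
  have p3 := abs_le.1 ((S.m_abs htT).trans (hA t htT))
  have p4 := abs_le.1 ((S.m_abs htsT).trans (hA ts htsT))
  have p5 := mul_nonneg hc0.le (S.E_nonneg htT)
  have p6 := mul_le_mul_of_nonneg_left ((S.E_le htsT).trans hE) hc0.le
  have p7 := hmax' r hr t ⟨ht.1, le_rfl⟩
  simp only [hΦ] at p7
  linarith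

end Sol

lemma sol_bound {μ β γ R M : ℝ} (hμ : 0 < μ) (hβ : 1 < β) (hγ : 1 < γ) (hβγ : β ≤ γ) (hR : 0 < R)
    (hM : 0 ≤ M) :
    ∃ C > 0, ∀ T : ℝ, ∀ S : Sol μ β γ R T, S.E 0 ≤ M → S.X 0 ≤ M →
      (∀ r ∈ Icc 0 R, S.ρ r 0 ≤ M) →
      ∀ r ∈ Icc 0 R, ∀ t ∈ Icc 0 T, S.ρ r t ≤ C := by
  obtain ⟨C, hC, hA⟩ := mom_bound hμ hβ hγ hβγ hR hM
  set B := 1 + M + (3 * γ * M / R ^ 2 + 1 / 2) with hB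
  have hq : 0 ≤ 3 * γ * M / R ^ 2 := by positivity
  have hB1 : 1 ≤ B := by linarith
  have hlogB := Real.log_nonneg hB1
  set D := 1 + β * (2 * μ * Real.log B + B ^ β / β + 4 * C + (1 / (2 * μ) + 1 / R ^ 2) * M) with hD
  have hD1 : 1 ≤ D := by
    have : 0 ≤ β * (2 * μ * Real.log B + B ^ β / β + 4 * C + (1 / (2 * μ) + 1 / R ^ 2) * M) := by
      positivity
    linarith
  refine ⟨D ^ (2 / (β - 1)), by positivity, fun T S hE0 hX0 hρ0 => ?_⟩
  have hT := S.hT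
  -- maximum of the density
  obtain ⟨⟨rs, ts⟩, ⟨hrs, hts⟩, hmax⟩ := (isCompact_Icc.prod isCompact_Icc).exists_isMaxOn
    (⟨(0, 0), ⟨le_rfl, hR.le⟩, le_rfl, hT.le⟩ : (Icc (0:ℝ) R ×ˢ Icc 0 T).Nonempty)
    S.cρ.continuousOn
  simp only at hrs hts
  have hmax' : ∀ x ∈ Icc 0 R, ∀ y ∈ Icc 0 T, S.ρ x y ≤ S.ρ rs ts := fun x hx y hy =>
    hmax (a := (x, y)) ⟨hx, hy⟩
  set N := max 1 (S.ρ rs ts) with hN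
  have hN1 : 1 ≤ N := le_max_left _ _
  have hN0 : 0 < N := by linarith
  have hρN : ∀ x ∈ Icc 0 R, ∀ y ∈ Icc 0 T, S.ρ x y ≤ N := fun x hx y hy =>
    (hmax' x hx y hy).trans (le_max_right _ _)
  set a := N ^ ((β + 1) / 2) with ha
  have ha1 : 1 ≤ a := Real.one_le_rpow hN1 (by linarith)
  have haN : N ≤ a := by
    conv_lhs => rw [← Real.rpow_one N]
    exact Real.rpow_le_rpow_of_exponent_le hN1 (by linarith)
  have hIco : ∀ r ∈ Icc 0 R, ∀ t ∈ Ico 0 T, S.L r t ≤ D * a := by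
    intro r hr t ht
    have htT := Ico_subset_Icc_self ht
    have hpos := S.pos r hr t htT
    rcases le_total (S.ρ r t) 1 with h | h
    · rw [S.hL]
      have := Real.rpow_le_one hpos.le h (by linarith : 0 ≤ β)
      have : 1 ≤ D * a := one_le_mul_of_one_le_of_one_le hD1 ha1
      linarith
    · have h1 := S.θ_bound hβγ hr ht hρN hE0 (fun t ht => hA T S N hN1 hρN hE0 hX0 t ht) hB1
        (by linarith) (fun r hr => (hρ0 r hr).trans (by linarith))
      unfold Sol.θ at h1
      have h2 := Real.log_nonneg h
      have h2' : 0 ≤ 2 * μ * Real.log (S.ρ r t) := by positivity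
      have h3 : S.L r t / β ≤ (2 * μ * Real.log B + B ^ β / β + 4 * C
          + (1 / (2 * μ) + 1 / R ^ 2) * M) * a := by
        have k1 : 2 * μ * Real.log B + B ^ β / β ≤ (2 * μ * Real.log B + B ^ β / β) * a :=
          le_mul_of_one_le_right (by positivity) ha1
        have k2 : (N / (2 * μ) + 1 / R ^ 2) * M ≤ (1 / (2 * μ) + 1 / R ^ 2) * M * a := by
          have e1 : N / (2 * μ) ≤ 1 / (2 * μ) * a := by
            rw [one_div, inv_mul_eq_div]; gcongr
          have e2 : 1 / R ^ 2 ≤ 1 / R ^ 2 * a := le_mul_of_one_le_right (by positivity) ha1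
          have := mul_le_mul_of_nonneg_right (add_le_add e1 e2) hM
          linarith
        linarith
      rw [div_le_iff₀ (by linarith)] at h3
      rw [hD]
      have : 0 ≤ a := by linarith
      linarith
  have hIcc : ∀ r ∈ Icc 0 R, ∀ t ∈ Icc 0 T, S.L r t ≤ D * a := by
    intro r hr t ht
    have hc : ContinuousOn (fun t => S.L r t) (Icc 0 T) :=
      S.cL.comp (f := fun t : ℝ => (r, t)) (by fun_prop) (fun t ht => ⟨hr, ht⟩)
    rw [← closure_Ico hT.ne] at ht hc
    exact le_on_closure (hIco r hr) hc continuousOn_const ht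
  have hNle : N ^ β ≤ D * a := by
    rcases max_choice 1 (S.ρ rs ts) with h | h
    · rw [hN, h, Real.one_rpow]
      exact one_le_mul_of_one_le_of_one_le hD1 ha1
    · rw [hN, h, ← S.hL]
      exact hIcc rs hrs ts hts
  have hNd : N ^ ((β - 1) / 2) ≤ D := by
    have e : N ^ β = N ^ ((β - 1) / 2) * a := by
      rw [ha, ← Real.rpow_add hN0]; congr 1; ring
    rw [e] at hNle
    exact le_of_mul_le_mul_right hNle (by linarith)
  have hfin : N ≤ D ^ (2 / (β - 1)) := by
    have h1 := Real.rpow_le_rpow (by positivity) hNd (by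
      apply div_nonneg <;> linarith : 0 ≤ 2 / (β - 1))
    rw [← Real.rpow_mul hN0.le] at h1
    have : (β - 1) / 2 * (2 / (β - 1)) = 1 := by
      have : β - 1 ≠ 0 := by linarith
      field_simp
    rwa [this, Real.rpow_one] at h1
  exact fun r hr t ht => (hρN r hr t ht).trans hfin

/-- partial derivative in the first variable -/
def pr (f : ℝ → ℝ → ℝ) (r t : ℝ) : ℝ := fderiv ℝ (Function.uncurry f) (r, t) (1, 0)
/-- partial derivative in the second variable -/
def pt (f : ℝ → ℝ → ℝ) (r t : ℝ) : ℝ := fderiv ℝ (Function.uncurry f) (r, t) (0, 1)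

def Smooth2 (f : ℝ → ℝ → ℝ) : Prop := ∀ n : ℕ, ContDiff ℝ n (Function.uncurry f)

namespace Smooth2

variable {f : ℝ → ℝ → ℝ}

lemma cont (hf : Smooth2 f) : Continuous (fun p : ℝ × ℝ => f p.1 p.2) := (hf 0).continuous

lemma pr (hf : Smooth2 f) : Smooth2 (pr f) := fun n => by
  have h : ContDiff ℝ n (fderiv ℝ (Function.uncurry f)) :=
    (hf (n + 1)).fderiv_right (by norm_cast)
  exact h.clm_apply contDiff_const

lemma pt (hf : Smooth2 f) : Smooth2 (pt f) := fun n => by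
  have h : ContDiff ℝ n (fderiv ℝ (Function.uncurry f)) :=
    (hf (n + 1)).fderiv_right (by norm_cast)
  exact h.clm_apply contDiff_const

lemma hfd (hf : Smooth2 f) (r t : ℝ) : HasFDerivAt (Function.uncurry f)
    (fderiv ℝ (Function.uncurry f) (r, t)) (r, t) :=
  ((hf 1).differentiable (by norm_num) (r, t)).hasFDerivAt

lemma dr (hf : Smooth2 f) (r t : ℝ) : HasDerivAt (fun s => f s t) (_root_.pr f r t) r := by
  have h2 : HasDerivAt (fun s : ℝ => (s, t)) ((1:ℝ), (0:ℝ)) r :=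
    (hasDerivAt_id r).prodMk (hasDerivAt_const r t)
  exact HasFDerivAt.comp_hasDerivAt (x := r) (f := fun s : ℝ => (s, t)) (hf.hfd r t) h2

lemma dt (hf : Smooth2 f) (r t : ℝ) : HasDerivAt (fun τ => f r τ) (_root_.pt f r t) t := by
  have h2 : HasDerivAt (fun τ : ℝ => (r, τ)) ((0:ℝ), (1:ℝ)) t :=
    (hasDerivAt_const t r).prodMk (hasDerivAt_id t)
  exact HasFDerivAt.comp_hasDerivAt (x := t) (f := fun τ : ℝ => (r, τ)) (hf.hfd r t) h2

lemma symm (hf : Smooth2 f) (r t : ℝ) :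
    _root_.pt (_root_.pr f) r t = _root_.pr (_root_.pt f) r t := by
  have hs : IsSymmSndFDerivAt ℝ (Function.uncurry f) (r, t) :=
    (hf 2).contDiffAt.isSymmSndFDerivAt (by simp)
  have hd : DifferentiableAt ℝ (fderiv ℝ (Function.uncurry f)) (r, t) :=
    ((hf 2).fderiv_right (m := 1) (by norm_cast)).differentiable (by norm_num) (r, t)
  have e : ∀ a b : ℝ × ℝ, fderiv ℝ (fun p => fderiv ℝ (Function.uncurry f) p a) (r, t) b =
      fderiv ℝ (fderiv ℝ (Function.uncurry f)) (r, t) b a := by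
    intro a b
    have := hd.hasFDerivAt.clm_apply (hasFDerivAt_const a (r, t))
    rw [this.fderiv]
    simp
  have e1 : _root_.pt (_root_.pr f) r t =
      fderiv ℝ (fun p => fderiv ℝ (Function.uncurry f) p (1, 0)) (r, t) (0, 1) := rfl
  have e2 : _root_.pr (_root_.pt f) r t =
      fderiv ℝ (fun p => fderiv ℝ (Function.uncurry f) p (0, 1)) (r, t) (1, 0) := rfl
  rw [e1, e2, e, e]
  exact hs.eq _ _

end Smooth2

lemma hasDerivAt_int01 {g g' : ℝ → ℝ → ℝ} (hg : Continuous (fun p : ℝ × ℝ => g p.1 p.2))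
    (hg' : Continuous (fun p : ℝ × ℝ => g' p.1 p.2))
    (hd : ∀ s x, HasDerivAt (fun y => g s y) (g' s x) x) (x : ℝ) :
    HasDerivAt (fun y => ∫ s in (0:ℝ)..1, g s y) (∫ s in (0:ℝ)..1, g' s x) x := by
  have h := hasDerivAt_param (a := 0) (R := 1) (T := 2) zero_le_one
    (f := fun s y => g s (y + (x - 1))) (f' := fun s y => g' s (y + (x - 1)))
    (fun t _ => by fun_prop) (by fun_prop)
    (fun s _ t _ => (hd s (t + (x - 1))).comp_add_const t (x - 1)) (t0 := 1) (by norm_num)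
  have e : (1:ℝ) + (x - 1) = x := by ring
  rw [e] at h
  have e2 : (1:ℝ) = x - (x - 1) := by ring
  rw [e2] at h
  have h3 := h.comp_sub_const x (x - 1)
  simpa using h3

/-- `g(r,t) = (f(r,t) - f(0,t))/r` -/
def avg (f : ℝ → ℝ → ℝ) (r t : ℝ) : ℝ := ∫ s in (0:ℝ)..1, pr f (s * r) t

lemma avg_cont {f : ℝ → ℝ → ℝ} (hf : Smooth2 f) :
    Continuous (fun p : ℝ × ℝ => avg f p.1 p.2) := by
  have := hf.pr.cont
  exact intervalIntegral.continuous_parametric_intervalIntegral_of_continuous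
      (f := fun (p : ℝ × ℝ) s => pr f (s * p.1) p.2) (by fun_prop) continuous_const

lemma avg_mul {f : ℝ → ℝ → ℝ} (hf : Smooth2 f) (r t : ℝ) :
    r * avg f r t = f r t - f 0 t := by
  have c := hf.pr.cont; have c' := hf.cont
  have h := intervalIntegral.integral_eq_sub_of_hasDerivAt (a := 0) (b := 1)
    (f := fun s => f (s * r) t) (f' := fun s => pr f (s * r) t * r)
    (fun s _ => by
      have h1 : HasDerivAt (fun s : ℝ => s * r) r s := by
        simpa using (hasDerivAt_id s).mul_const r
      exact HasDerivAt.comp s (hf.dr (s * r) t) h1)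
    (Continuous.intervalIntegrable (by fun_prop) _ _)
  rw [intervalIntegral.integral_mul_const] at h
  simp only [one_mul, zero_mul] at h
  rw [← h, avg, mul_comm]

def avgr (f : ℝ → ℝ → ℝ) (r t : ℝ) : ℝ := ∫ s in (0:ℝ)..1, s * pr (pr f) (s * r) t

lemma avgr_cont {f : ℝ → ℝ → ℝ} (hf : Smooth2 f) :
    Continuous (fun p : ℝ × ℝ => avgr f p.1 p.2) := by
  have := hf.pr.pr.cont
  exact intervalIntegral.continuous_parametric_intervalIntegral_of_continuous
      (f := fun (p : ℝ × ℝ) s => s * pr (pr f) (s * p.1) p.2) (by fun_prop) continuous_const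

lemma avg_dr {f : ℝ → ℝ → ℝ} (hf : Smooth2 f) (r t : ℝ) :
    HasDerivAt (fun s => avg f s t) (avgr f r t) r := by
  have c1 := hf.pr.pr.cont; have c2 := hf.pr.cont
  refine hasDerivAt_int01 (g := fun s x => pr f (s * x) t)
    (g' := fun s x => s * pr (pr f) (s * x) t) (by fun_prop) (by fun_prop) (fun s x => ?_) r
  have h1 : HasDerivAt (fun x : ℝ => s * x) s x := by
    simpa using (hasDerivAt_id x).const_mul s
  have := HasDerivAt.comp x (hf.pr.dr (s * x) t) h1
  exact this.congr_deriv (mul_comm _ _)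

lemma avg_dt {f : ℝ → ℝ → ℝ} (hf : Smooth2 f) (r t : ℝ) :
    HasDerivAt (fun τ => avg f r τ) (avg (pt f) r t) t := by
  have c1 := hf.pr.pt.cont; have c2 := hf.pr.cont
  have h := hasDerivAt_int01 (g := fun s x => pr f (s * r) x)
    (g' := fun s x => pt (pr f) (s * r) x) (by fun_prop) (by fun_prop)
    (fun s x => hf.pr.dt (s * r) x) t
  refine h.congr_deriv ?_
  rw [avg]
  refine intervalIntegral.integral_congr fun s _ => ?_
  exact hf.symm _ _

lemma eqOn_Icc {R : ℝ} (hR : 0 < R) {f g : ℝ → ℝ} (h : EqOn f g (Ioo 0 R))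
    (hf : ContinuousOn f (Icc 0 R)) (hg : ContinuousOn g (Icc 0 R)) : EqOn f g (Icc 0 R) :=
  h.of_subset_closure hf hg Ioo_subset_Icc_self (by rw [closure_Ioo hR.ne])

lemma pt_bdry {T a : ℝ} (hT : 0 < T) {u : ℝ → ℝ → ℝ} (hu : Smooth2 u)
    (h : ∀ t ∈ Icc 0 T, u a t = 0) : ∀ t ∈ Icc 0 T, pt u a t = 0 := by
  have c := hu.pt.cont
  refine eqOn_Icc hT (f := fun t => pt u a t) (g := fun _ => 0) (fun t ht => ?_)
    (by fun_prop) (by fun_prop)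
  have h1 : (fun τ => u a τ) =ᶠ[nhds t] fun _ => 0 := by
    filter_upwards [Icc_mem_nhds ht.1 ht.2] with τ hτ
    exact h τ hτ
  exact (hu.dt a t).unique ((hasDerivAt_const t (0:ℝ)).congr_of_eventuallyEq h1)

namespace RadialSolution

variable {μ β γ R T : ℝ} {ρ u : ℝ → ℝ → ℝ}

lemma div_eq (S : RadialSolution μ β γ R T ρ u) {r t : ℝ} (hr : r ∈ Ioo 0 R) (ht : t ∈ Icc 0 T) :
    u r t / r = avg u r t := by
  have := avg_mul (f := u) S.smooth_u r t
  rw [S.bc0 t ht, sub_zero] at this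
  rw [← this, mul_div_cancel_left₀ _ hr.1.ne']

lemma mass' (S : RadialSolution μ β γ R T ρ u) : ∀ r ∈ Icc 0 R, ∀ t ∈ Icc 0 T,
    pt ρ r t = -(u r t * pr ρ r t) - ρ r t * (pr u r t + avg u r t) := by
  intro r hr t ht
  have hρ : Smooth2 ρ := S.smooth_ρ
  have hu : Smooth2 u := S.smooth_u
  have c1 := hρ.cont; have c2 := hu.cont; have c3 := hρ.pt.cont; have c4 := hρ.pr.cont
  have c5 := hu.pr.cont; have c6 := avg_cont hu
  refine eqOn_Icc S.hR (f := fun r => pt ρ r t)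
    (g := fun r => -(u r t * pr ρ r t) - ρ r t * (pr u r t + avg u r t)) (fun r hr => ?_)
    (by fun_prop) (by fun_prop) hr
  have h := S.mass r hr t ht
  have e0 : deriv (fun s => ρ s t * u s t) r = pr ρ r t * u r t + ρ r t * pr u r t :=
    ((hρ.dr r t).mul (hu.dr r t)).deriv
  rw [(hρ.dt r t).deriv, e0, mul_div_assoc, S.div_eq hr ht] at h
  simp only
  linarith

lemma pow_r (S : RadialSolution μ β γ R T ρ u) (p : ℝ) {r t : ℝ} (hr : r ∈ Icc 0 R)
    (ht : t ∈ Icc 0 T) :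
    HasDerivAt (fun s => ρ s t ^ p) (pr ρ r t * p * ρ r t ^ (p - 1)) r := by
  have hρ : Smooth2 ρ := S.smooth_ρ
  exact (hρ.dr r t).rpow_const (Or.inl (S.ρ_pos r hr t ht).ne')

lemma pow_t (S : RadialSolution μ β γ R T ρ u) (p : ℝ) {r t : ℝ} (hr : r ∈ Icc 0 R)
    (ht : t ∈ Icc 0 T) :
    HasDerivAt (fun τ => ρ r τ ^ p) (-(u r t * (pr ρ r t * p * ρ r t ^ (p - 1)))
      - p * ρ r t ^ p * (pr u r t + avg u r t)) t := by
  have hρ : Smooth2 ρ := S.smooth_ρ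
  have hpos := S.ρ_pos r hr t ht
  refine ((hρ.dt r t).rpow_const (p := p) (Or.inl hpos.ne')).congr_deriv ?_
  rw [S.mass' r hr t ht]
  have : ρ r t ^ p = ρ r t ^ (p - 1) * ρ r t := by
    rw [← Real.rpow_add_one hpos.ne']; congr 1; ring
  rw [this]; ring

lemma pow_cont (S : RadialSolution μ β γ R T ρ u) (p : ℝ) :
    ContinuousOn (fun x : ℝ × ℝ => ρ x.1 x.2 ^ p) (Icc 0 R ×ˢ Icc 0 T) := by
  have hρ : Smooth2 ρ := S.smooth_ρ
  refine hρ.cont.continuousOn.rpow_const ?_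
  rintro ⟨r, t⟩ ⟨hr, ht⟩
  exact Or.inl (S.ρ_pos r hr t ht).ne'

lemma powr_cont (S : RadialSolution μ β γ R T ρ u) (p : ℝ) :
    ContinuousOn (fun x : ℝ × ℝ => pr ρ x.1 x.2 * p * ρ x.1 x.2 ^ (p - 1))
      (Icc 0 R ×ˢ Icc 0 T) := by
  have hρ : Smooth2 ρ := S.smooth_ρ
  exact (hρ.pr.cont.continuousOn.mul continuousOn_const).mul (S.pow_cont (p - 1))

lemma mom' (S : RadialSolution μ β γ R T ρ u) : ∀ r ∈ Icc 0 R, ∀ t ∈ Icc 0 T,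
    (pr ρ r t * β * ρ r t ^ (β - 1)) * (pr u r t + avg u r t)
      + (2 * μ + ρ r t ^ β) * (pr (pr u) r t + avgr u r t)
      - (pr ρ r t * γ * ρ r t ^ (γ - 1)) = ρ r t * (pt u r t + u r t * pr u r t) := by
  intro r hr t ht
  have hρ : Smooth2 ρ := S.smooth_ρ
  have hu : Smooth2 u := S.smooth_u
  have c1 := hρ.cont; have c2 := hu.cont; have c3 := hρ.pt.cont; have c4 := hρ.pr.cont
  have c5 := hu.pr.cont; have c6 := avg_cont hu; have c7 := avgr_cont hu
  have c8 := hu.pr.pr.cont; have c9 := hu.pt.cont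
  have c10 := slice (f := fun r t => pr ρ r t * β * ρ r t ^ (β - 1)) ht (S.powr_cont β)
  have c11 := slice (f := fun r t => pr ρ r t * γ * ρ r t ^ (γ - 1)) ht (S.powr_cont γ)
  have c12 := slice (f := fun r t => ρ r t ^ β) ht (S.pow_cont β)
  refine eqOn_Icc S.hR (f := fun r => (pr ρ r t * β * ρ r t ^ (β - 1)) * (pr u r t + avg u r t)
      + (2 * μ + ρ r t ^ β) * (pr (pr u) r t + avgr u r t)
      - (pr ρ r t * γ * ρ r t ^ (γ - 1))) (g := fun r => ρ r t * (pt u r t + u r t * pr u r t))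
    (fun r hr => ?_) (((c10.mul (by fun_prop)).add ((continuousOn_const.add c12).mul
      (by fun_prop))).sub c11) (by fun_prop) hr
  have hrc := Ioo_subset_Icc_self hr
  have h := S.momentum r hr t ht
  have e1 : deriv (fun s => (2 * μ + ρ s t ^ β) * rdiv u s t) r =
      (pr ρ r t * β * ρ r t ^ (β - 1)) * (pr u r t + avg u r t)
      + (2 * μ + ρ r t ^ β) * (pr (pr u) r t + avgr u r t) := by
    have hev : (fun s => (2 * μ + ρ s t ^ β) * rdiv u s t) =ᶠ[nhds r]
        fun s => (2 * μ + ρ s t ^ β) * (pr u s t + avg u s t) := by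
      filter_upwards [Ioo_mem_nhds hr.1 hr.2] with s hs
      rw [rdiv, (hu.dr s t).deriv, S.div_eq hs ht]
    rw [hev.deriv_eq]
    exact (((S.pow_r β hrc ht).const_add (2 * μ)).mul
      ((hu.pr.dr r t).add (avg_dr hu r t))).deriv
  have e2 : deriv (fun s => ρ s t * u s t ^ 2) r =
      pr ρ r t * u r t ^ 2 + ρ r t * (2 * u r t * pr u r t) := by
    have := ((hρ.dr r t).mul ((hu.dr r t).pow 2)).deriv
    refine this.trans ?_
    simp
  have e3 : ρ r t * u r t ^ 2 / r = ρ r t * u r t * avg u r t := by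
    rw [← S.div_eq hr ht]; ring
  have e0 : deriv (fun τ => ρ r τ * u r τ) t = pt ρ r t * u r t + ρ r t * pt u r t :=
    ((hρ.dt r t).mul (hu.dt r t)).deriv
  rw [e1, e2, e3, (S.pow_r γ hrc ht).deriv, e0, S.mass' r hrc t ht] at h
  simp only
  linarith

/-- the working package of data attached to a radial solution -/
def toSol (S : RadialSolution μ β γ R T ρ u) : Sol μ β γ R T where
  ρ := ρ
  ρr := pr ρ
  u := u
  ur := pr u
  ut := pt u
  v := avg u
  w := fun r t => pr u r t + avg u r t
  wr := fun r t => pr (pr u) r t + avgr u r t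
  wt := fun r t => pt (pr u) r t + avg (pt u) r t
  L := fun r t => ρ r t ^ β
  Lr := fun r t => pr ρ r t * β * ρ r t ^ (β - 1)
  P := fun r t => ρ r t ^ γ
  Pr := fun r t => pr ρ r t * γ * ρ r t ^ (γ - 1)
  hμ := S.hμ
  hβ := S.hβ
  hγ := S.hγ
  hR := S.hR
  hT := S.hT
  cρ := Smooth2.cont S.smooth_ρ
  cu := Smooth2.cont S.smooth_u
  cρr := (Smooth2.pr S.smooth_ρ).cont
  cur := (Smooth2.pr S.smooth_u).cont
  cut := (Smooth2.pt S.smooth_u).cont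
  cv := avg_cont S.smooth_u
  cw := (Smooth2.pr S.smooth_u).cont.add (avg_cont S.smooth_u)
  cwr := (Smooth2.pr (Smooth2.pr S.smooth_u)).cont.add (avgr_cont S.smooth_u)
  cwt := (Smooth2.pt (Smooth2.pr S.smooth_u)).cont.add (avg_cont (Smooth2.pt S.smooth_u))
  cL := S.pow_cont β
  cLr := S.powr_cont β
  cP := S.pow_cont γ
  cPr := S.powr_cont γ
  pos := S.ρ_pos
  dρr := fun r _ t _ => Smooth2.dr S.smooth_ρ r t
  dρt := fun r hr t ht => by
    rw [← S.mass' r hr t ht]; exact Smooth2.dt S.smooth_ρ r t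
  dur := fun r _ t _ => Smooth2.dr S.smooth_u r t
  dut := fun r _ t _ => Smooth2.dt S.smooth_u r t
  dwr := fun r _ t _ => (Smooth2.dr (Smooth2.pr S.smooth_u) r t).add (avg_dr S.smooth_u r t)
  dwt := fun r _ t _ => (Smooth2.dt (Smooth2.pr S.smooth_u) r t).add (avg_dt S.smooth_u r t)
  dLr := fun r hr t ht => S.pow_r β hr ht
  dLt := fun r hr t ht => S.pow_t β hr ht
  dPr := fun r hr t ht => S.pow_r γ hr ht
  dPt := fun r hr t ht => S.pow_t γ hr ht
  dru := fun r hr t ht => by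
    have hu : Smooth2 u := S.smooth_u
    refine ((hasDerivAt_id r).mul (hu.pt.dr r t)).congr_deriv ?_
    have h1 := avg_mul hu.pt r t
    rw [pt_bdry S.hT hu S.bc0 t ht, sub_zero] at h1
    rw [hu.symm, mul_add, h1]
    simp only [id]
    ring
  mom := S.mom'
  hv := fun r hr t ht => by
    have := avg_mul (f := u) S.smooth_u r t
    rw [S.bc0 t ht, sub_zero] at this
    exact this.symm
  hw := fun _ _ _ _ => rfl
  bcR := S.bcR
  bcRt := pt_bdry S.hT S.smooth_u S.bcR
  hL := fun _ _ => rfl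
  hP := fun _ _ => rfl

end RadialSolution

lemma init_bound {μ β γ R T M J : ℝ} (S : Sol μ β γ R T) (hρ : ∀ r ∈ Icc 0 R, S.ρ r 0 ≤ M)
    (hJ : ∫ r in (0:ℝ)..R, (S.u r 0 ^ 2 + (S.ur r 0 ^ 2 + S.v r 0 ^ 2)) * r ≤ J) :
    S.E 0 ≤ M / 2 * J + M ^ γ / (γ - 1) * (R ^ 2 / 2) ∧ S.X 0 ≤ 2 * (2 * μ + M ^ β) * J := by
  have hT := S.hT
  have h0 : (0:ℝ) ∈ Icc 0 T := ⟨le_rfl, hT.le⟩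
  have c1 := S.cρ; have c2 := S.cu; have c4 := S.cw; have c8 := S.cv; have c9 := S.cur
  have c11 := slice h0 S.cP; have c12 := slice h0 S.cL
  have hR := S.hR; have hγ := S.hγ; have hμ := S.hμ
  have hγ1 : 0 < γ - 1 := by linarith
  have hM0 : 0 < M := (S.pos 0 ⟨le_rfl, hR.le⟩ 0 h0).trans_le (hρ 0 ⟨le_rfl, hR.le⟩)
  constructor
  · have h1 : S.E 0 ≤ ∫ r in (0:ℝ)..R,
        (M / 2 * ((S.u r 0 ^ 2 + (S.ur r 0 ^ 2 + S.v r 0 ^ 2)) * r) + M ^ γ / (γ - 1) * r) := by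
      refine int_mono hR.le (by fun_prop) (by fun_prop) fun r hr => ?_
      have hP : S.P r 0 / (γ - 1) ≤ M ^ γ / (γ - 1) := by
        have := S.P_le hr h0 (hρ r hr)
        gcongr
      have k1 : S.ρ r 0 * S.u r 0 ^ 2 ≤ M * (S.u r 0 ^ 2 + (S.ur r 0 ^ 2 + S.v r 0 ^ 2)) := by
        refine mul_le_mul (hρ r hr) ?_ (sq_nonneg _) hM0.le
        linarith [sq_nonneg (S.ur r 0), sq_nonneg (S.v r 0)]
      have k2 : S.ρ r 0 * S.u r 0 ^ 2 / 2 + S.P r 0 / (γ - 1) ≤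
        M / 2 * (S.u r 0 ^ 2 + (S.ur r 0 ^ 2 + S.v r 0 ^ 2)) + M ^ γ / (γ - 1) := by linarith
      have := mul_le_mul_of_nonneg_right k2 hr.1
      linarith
    rw [intervalIntegral.integral_add (ii_of hR.le (by fun_prop)) (ii_of hR.le (by fun_prop)),
      intervalIntegral.integral_const_mul, intervalIntegral.integral_const_mul,
      Sol.int_r hR.le] at h1
    have := mul_le_mul_of_nonneg_left hJ (by positivity : 0 ≤ M / 2)
    linarith
  · have h1 : S.X 0 ≤ ∫ r in (0:ℝ)..R,
        2 * (2 * μ + M ^ β) * ((S.u r 0 ^ 2 + (S.ur r 0 ^ 2 + S.v r 0 ^ 2)) * r) := by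
      refine int_mono hR.le (by fun_prop) (by fun_prop) fun r hr => ?_
      have hL := S.L_le hr h0 (hρ r hr)
      have hL0 := S.L_pos hr h0
      have k1 : S.w r 0 ^ 2 ≤ 2 * (S.u r 0 ^ 2 + (S.ur r 0 ^ 2 + S.v r 0 ^ 2)) := by
        rw [S.hw r hr 0 h0]
        nlinarith [sq_nonneg (S.ur r 0 - S.v r 0), sq_nonneg (S.u r 0)]
      have k2 : (2 * μ + S.L r 0) * S.w r 0 ^ 2 ≤
          (2 * μ + M ^ β) * (2 * (S.u r 0 ^ 2 + (S.ur r 0 ^ 2 + S.v r 0 ^ 2))) :=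
        mul_le_mul (by linarith) k1 (sq_nonneg _) (by positivity)
      have := mul_le_mul_of_nonneg_right k2 hr.1
      linarith
    rw [intervalIntegral.integral_const_mul] at h1
    exact h1.trans (mul_le_mul_of_nonneg_left hJ (by positivity))

/-- **Time-independent upper bound of the density.** If `γ > 1` and
`max{1, (γ+2)/4} < β ≤ γ`, then there is a constant `C` depending only on
`μ, β, γ, ‖ρ₀‖_{L^∞}, ‖u₀‖_{H¹}` (and `Ω`), but independent of `T`, such that
`sup_{[0,R]×[0,T]} ρ ≤ C` for every radially symmetric strong solution. -/
theorem density_uniform_bound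
    (μ β γ R M₁ M₂ : ℝ)
    (hμ : 0 < μ) (hγ : 1 < γ) (hβ : max 1 ((γ + 2) / 4) < β) (hβγ : β ≤ γ) (hR : 0 < R) :
    ∃ C > 0, ∀ T > 0, ∀ ρ u : ℝ → ℝ → ℝ,
      RadialSolution μ β γ R T ρ u →
      (∀ r ∈ Icc (0:ℝ) R, ρ r 0 ≤ M₁) →
      (2 * Real.pi * (∫ r in Ioo (0:ℝ) R, ((u r 0) ^ 2 + gradSq u r 0) * r) ≤ M₂) →
      ∀ r ∈ Icc (0:ℝ) R, ∀ t ∈ Icc (0:ℝ) T, ρ r t ≤ C := by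
  have hβ1 : 1 < β := (le_max_left _ _).trans_lt hβ
  have hγ1 : 0 < γ - 1 := by linarith
  set M := max 1 M₁ with hM
  have hM1 : 1 ≤ M := le_max_left _ _
  set J := |M₂| with hJ
  have hJ0 : 0 ≤ J := abs_nonneg _
  have q1 : 0 ≤ M / 2 * J + M ^ γ / (γ - 1) * (R ^ 2 / 2) := by positivity
  have q2 : 0 ≤ 2 * (2 * μ + M ^ β) * J := by positivity
  obtain ⟨C, hC, hb⟩ := sol_bound (μ := μ) (β := β) (γ := γ) (R := R)
    (M := M + (M / 2 * J + M ^ γ / (γ - 1) * (R ^ 2 / 2)) + 2 * (2 * μ + M ^ β) * J)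
    hμ hβ1 hγ hβγ hR (by linarith)
  refine ⟨C, hC, fun T hT ρ u S hρ hu => ?_⟩
  have h0 : (0:ℝ) ∈ Icc 0 T := ⟨le_rfl, hT.le⟩
  have hρM : ∀ r ∈ Icc 0 R, S.toSol.ρ r 0 ≤ M := fun r hr => (hρ r hr).trans (le_max_right _ _)
  have hsm : Smooth2 u := S.smooth_u
  have hJeq : ∫ r in (0:ℝ)..R, (S.toSol.u r 0 ^ 2 + (S.toSol.ur r 0 ^ 2 + S.toSol.v r 0 ^ 2)) * r
      = ∫ r in Ioo (0:ℝ) R, ((u r 0) ^ 2 + gradSq u r 0) * r := by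
    rw [intervalIntegral.integral_of_le hR.le, integral_Ioc_eq_integral_Ioo]
    refine setIntegral_congr_fun measurableSet_Ioo fun r hr => ?_
    simp only [gradSq]
    rw [(hsm.dr r 0).deriv, S.div_eq hr h0]
    rfl
  have hnn : 0 ≤ ∫ r in (0:ℝ)..R,
      (S.toSol.u r 0 ^ 2 + (S.toSol.ur r 0 ^ 2 + S.toSol.v r 0 ^ 2)) * r :=
    int_nonneg hR.le fun r hr => mul_nonneg (by positivity) hr.1
  have hJb : ∫ r in (0:ℝ)..R,
      (S.toSol.u r 0 ^ 2 + (S.toSol.ur r 0 ^ 2 + S.toSol.v r 0 ^ 2)) * r ≤ J := by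
    rw [← hJeq] at hu
    have hpi := Real.pi_gt_three
    have := le_mul_of_one_le_left hnn (by linarith : 1 ≤ 2 * Real.pi)
    exact this.trans (hu.trans (le_abs_self _))
  obtain ⟨hE, hX⟩ := init_bound S.toSol hρM hJb
  exact hb T S.toSol (by linarith) (by linarith)
    (fun r hr => (hρM r hr).trans (by linarith))
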